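/- Let p_{Y1,Y2|X} be a discrete memoryless broadcast channel whose marginal channels p_{Y1|X} and p_{Y2|X} are binary erasure channels with erasure probabilities ε1 and ε2 respectively, where 0 ≤ ε1 ≤ ε2 ≤ 1. Then: (i) 𝒞₁(p_{Y1,Y2|X}) = 𝒞(p_{Y1,Y2|X}) = {(R1,R2) ∈ ℝ²₊ : ∃β ∈ [0,1], R1 ≤ β(1−ε1) and R2 ≤ (1−β)(1−ε2)}; (ii) 𝒞₂(p_{Y1,Y2|X}) = {(R1,R2) ∈ ℝ²₊ : R2 ≤ 1−ε2 and R1+R2 ≤ 1−ε1}. -/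

import Mathlib

open scoped BigOperators Classical
open Finset

noncomputable section

/-- `p` is a probability mass function on the finite type `α`. -/
def IsPMF {α : Type} [Fintype α] (p : α → ℝ) : Prop :=
  (∀ a, 0 ≤ p a) ∧ ∑ a, p a = 1

/-- Shannon entropy (base 2) of a pmf on a finite type. -/
def Hent {α : Type} [Fintype α] (p : α → ℝ) : ℝ :=
  -∑ a, p a * Real.logb 2 (p a)

/-- Mutual information `I(A;B)` of a joint pmf on `α × β` (base-2 logarithms). -/
def MI {α β : Type} [Fintype α] [Fintype β] (p : α × β → ℝ) : ℝ :=
  Hent (fun a => ∑ b, p (a, b)) + Hent (fun b => ∑ a, p (a, b)) - Hent p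

/-- Conditional mutual information `I(A;B|C)` of a joint pmf on `α × β × γ`. -/
def CMI {α β γ : Type} [Fintype α] [Fintype β] [Fintype γ] (p : α × β × γ → ℝ) : ℝ :=
  Hent (fun ac : α × γ => ∑ b, p (ac.1, b, ac.2))
    + Hent (fun bc : β × γ => ∑ a, p (a, bc.1, bc.2))
    - Hent p
    - Hent (fun c : γ => ∑ a, ∑ b, p (a, b, c))

/-- A channel: every input letter gives a pmf on outputs. -/
def IsChannel {X Z : Type} [Fintype Z] (W : X → Z → ℝ) : Prop :=
  ∀ x, IsPMF (W x)

/-- Marginal channel to receiver 1 of a broadcast channel. -/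
def margW1 {X Y1 Y2 : Type} [Fintype Y2] (W : X → Y1 × Y2 → ℝ) : X → Y1 → ℝ :=
  fun x y1 => ∑ y2, W x (y1, y2)

/-- Marginal channel to receiver 2 of a broadcast channel. -/
def margW2 {X Y1 Y2 : Type} [Fintype Y1] (W : X → Y1 × Y2 → ℝ) : X → Y2 → ℝ :=
  fun x y2 => ∑ y1, W x (y1, y2)

/-- Memoryless `n`-fold extension of a broadcast channel. -/
def nFold {X Y1 Y2 : Type} (W : X → Y1 × Y2 → ℝ) (n : ℕ)
    (x : Fin n → X) (y : (Fin n → Y1) × (Fin n → Y2)) : ℝ :=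
  ∏ t, W (x t) (y.1 t, y.2 t)

section Channel

variable {X Y1 Y2 : Type} [Fintype Y1] [Fintype Y2]

/-- Average error probability; message `M2` known at receiver 1. -/
def errP1 (W : X → Y1 × Y2 → ℝ) (n k1 k2 : ℕ) (f : Fin k1 × Fin k2 → Fin n → X)
    (g1 : (Fin n → Y1) × Fin k2 → Fin k1) (g2 : (Fin n → Y2) → Fin k2) : ℝ :=
  (1 : ℝ) / ((k1 : ℝ) * (k2 : ℝ)) *
    ∑ m : Fin k1 × Fin k2, ∑ y : (Fin n → Y1) × (Fin n → Y2),
      nFold W n (f m) y * (if g1 (y.1, m.2) = m.1 ∧ g2 y.2 = m.2 then 0 else 1)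

/-- Average error probability; message `M1` known at receiver 2. -/
def errP2 (W : X → Y1 × Y2 → ℝ) (n k1 k2 : ℕ) (f : Fin k1 × Fin k2 → Fin n → X)
    (g1 : (Fin n → Y1) → Fin k1) (g2 : (Fin n → Y2) × Fin k1 → Fin k2) : ℝ :=
  (1 : ℝ) / ((k1 : ℝ) * (k2 : ℝ)) *
    ∑ m : Fin k1 × Fin k2, ∑ y : (Fin n → Y1) × (Fin n → Y2),
      nFold W n (f m) y * (if g1 y.1 = m.1 ∧ g2 (y.2, m.1) = m.2 then 0 else 1)

/-- Average error probability; no receiver side information. -/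
def errP0 (W : X → Y1 × Y2 → ℝ) (n k1 k2 : ℕ) (f : Fin k1 × Fin k2 → Fin n → X)
    (g1 : (Fin n → Y1) → Fin k1) (g2 : (Fin n → Y2) → Fin k2) : ℝ :=
  (1 : ℝ) / ((k1 : ℝ) * (k2 : ℝ)) *
    ∑ m : Fin k1 × Fin k2, ∑ y : (Fin n → Y1) × (Fin n → Y2),
      nFold W n (f m) y * (if g1 y.1 = m.1 ∧ g2 y.2 = m.2 then 0 else 1)

/-- Achievability of a rate pair with `M2` available at receiver 1. -/
def Ach1 (W : X → Y1 × Y2 → ℝ) (R : ℝ × ℝ) : Prop :=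
  0 ≤ R.1 ∧ 0 ≤ R.2 ∧ ∀ ε : ℝ, 0 < ε →
    ∃ (n k1 k2 : ℕ), 0 < n ∧ 0 < k1 ∧ 0 < k2 ∧
      ∃ (f : Fin k1 × Fin k2 → Fin n → X) (g1 : (Fin n → Y1) × Fin k2 → Fin k1)
        (g2 : (Fin n → Y2) → Fin k2),
        R.1 ≤ Real.logb 2 (k1 : ℝ) / (n : ℝ) ∧ R.2 ≤ Real.logb 2 (k2 : ℝ) / (n : ℝ) ∧
        errP1 W n k1 k2 f g1 g2 ≤ ε

/-- Achievability of a rate pair with `M1` available at receiver 2. -/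
def Ach2 (W : X → Y1 × Y2 → ℝ) (R : ℝ × ℝ) : Prop :=
  0 ≤ R.1 ∧ 0 ≤ R.2 ∧ ∀ ε : ℝ, 0 < ε →
    ∃ (n k1 k2 : ℕ), 0 < n ∧ 0 < k1 ∧ 0 < k2 ∧
      ∃ (f : Fin k1 × Fin k2 → Fin n → X) (g1 : (Fin n → Y1) → Fin k1)
        (g2 : (Fin n → Y2) × Fin k1 → Fin k2),
        R.1 ≤ Real.logb 2 (k1 : ℝ) / (n : ℝ) ∧ R.2 ≤ Real.logb 2 (k2 : ℝ) / (n : ℝ) ∧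
        errP2 W n k1 k2 f g1 g2 ≤ ε

/-- Achievability of a rate pair with no receiver side information. -/
def Ach0 (W : X → Y1 × Y2 → ℝ) (R : ℝ × ℝ) : Prop :=
  0 ≤ R.1 ∧ 0 ≤ R.2 ∧ ∀ ε : ℝ, 0 < ε →
    ∃ (n k1 k2 : ℕ), 0 < n ∧ 0 < k1 ∧ 0 < k2 ∧
      ∃ (f : Fin k1 × Fin k2 → Fin n → X) (g1 : (Fin n → Y1) → Fin k1)
        (g2 : (Fin n → Y2) → Fin k2),
        R.1 ≤ Real.logb 2 (k1 : ℝ) / (n : ℝ) ∧ R.2 ≤ Real.logb 2 (k2 : ℝ) / (n : ℝ) ∧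
        errP0 W n k1 k2 f g1 g2 ≤ ε

/-- Capacity region `𝒞₁`: side information `M2` at receiver 1. -/
def Cap1 (W : X → Y1 × Y2 → ℝ) : Set (ℝ × ℝ) := closure {R | Ach1 W R}

/-- Capacity region `𝒞₂`: side information `M1` at receiver 2. -/
def Cap2 (W : X → Y1 × Y2 → ℝ) : Set (ℝ × ℝ) := closure {R | Ach2 W R}

/-- Private-message capacity region `𝒞`. -/
def Cap (W : X → Y1 × Y2 → ℝ) : Set (ℝ × ℝ) := closure {R | Ach0 W R}

end Channel

/-- `κ·𝒜` for a set of rate pairs. -/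
def scaleSet (κ : ℝ) (A : Set (ℝ × ℝ)) : Set (ℝ × ℝ) :=
  (fun R : ℝ × ℝ => (κ * R.1, κ * R.2)) '' A

/-- Binary entropy function (base 2). -/
def Hb (x : ℝ) : ℝ := -(x * Real.logb 2 x) - (1 - x) * Real.logb 2 (1 - x)

/-- Binary convolution `a*b = a(1-b)+(1-a)b`. -/
def bconv (a b : ℝ) : ℝ := a * (1 - b) + (1 - a) * b

/-- The region `𝒞(BS-BC(d₁,d₂))`. -/
def CBSBC (d1 d2 : ℝ) : Set (ℝ × ℝ) :=
  {R | 0 ≤ R.1 ∧ 0 ≤ R.2 ∧ ∃ α ∈ Set.Icc (0:ℝ) (1/2),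
    R.1 ≤ Hb (bconv α d1) - Hb d1 ∧ R.2 ≤ 1 - Hb (bconv α d2)}

/-- The region `𝒞(BE-BC(ε₁,ε₂))`. -/
def CBEBC (e1 e2 : ℝ) : Set (ℝ × ℝ) :=
  {R | 0 ≤ R.1 ∧ 0 ≤ R.2 ∧ ∃ β ∈ Set.Icc (0:ℝ) 1,
    R.1 ≤ β * (1 - e1) ∧ R.2 ≤ (1 - β) * (1 - e2)}

/-- 1-norm distance between two functions on a finite type. -/
def l1dist {α : Type} [Fintype α] (p q : α → ℝ) : ℝ := ∑ a, |p a - q a|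

/-- Capacity `C(p_{Y|X}) = max_{p_X} I(X;Y)` of a point-to-point channel. -/
def Cmarg {X Y : Type} [Fintype X] [Fintype Y] (Wm : X → Y → ℝ) : ℝ :=
  sSup {r | ∃ pX : X → ℝ, IsPMF pX ∧ r = MI (fun a : X × Y => pX a.1 * Wm a.1 a.2)}

/-- Transition kernel of the binary symmetric channel `BSC(p)`. -/
def BSCk (p : ℝ) : Bool → Bool → ℝ := fun x y => if y = x then 1 - p else p

/-- Transition kernel of the binary erasure channel `BEC(ε)`
(`none` is the erasure symbol). -/
def BECk (e : ℝ) : Bool → Option Bool → ℝ :=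
  fun x y => match y with
    | none => e
    | some b => if b = x then 1 - e else 0

section Expectation

variable {ι : Type} [DecidableEq ι]

/-- Expectation of `h S` where `S ⊆ A` keeps each element of `A` independently w.p. `p`. -/
def Ex (p : ℝ) (A : Finset ι) (h : Finset ι → ℝ) : ℝ :=
  ∑ S ∈ A.powerset, p ^ #S * (1 - p) ^ #(A \ S) * h S

lemma Ex_empty (p : ℝ) (h : Finset ι → ℝ) : Ex p ∅ h = h ∅ := by
  simp [Ex]

lemma Ex_insert (p : ℝ) {a : ι} {A : Finset ι} (ha : a ∉ A) (h : Finset ι → ℝ) :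
    Ex p (insert a A) h = (1 - p) * Ex p A h + p * Ex p A (fun S => h (insert a S)) := by
  unfold Ex
  rw [Finset.sum_powerset_insert ha, Finset.mul_sum, Finset.mul_sum]
  congr 1
  · refine Finset.sum_congr rfl fun S hS => ?_
    have haS : a ∉ S := fun h => ha (Finset.mem_powerset.1 hS h)
    rw [Finset.insert_sdiff_of_notMem _ haS, Finset.card_insert_of_notMem (by simp [ha])]
    ring
  · refine Finset.sum_congr rfl fun S hS => ?_
    have haS : a ∉ S := fun h => ha (Finset.mem_powerset.1 hS h)
    have : insert a A \ insert a S = A \ S := by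
      ext x; simp only [Finset.mem_sdiff, Finset.mem_insert]
      by_cases hx : x = a
      · subst hx; simp [ha]
      · simp [hx]
    rw [this, Finset.card_insert_of_notMem haS]
    ring

lemma Ex_mono {p : ℝ} (hp0 : 0 ≤ p) (hp1 : p ≤ 1) (A : Finset ι) {h h' : Finset ι → ℝ}
    (hh : ∀ S, S ⊆ A → h S ≤ h' S) : Ex p A h ≤ Ex p A h' := by
  unfold Ex
  refine Finset.sum_le_sum fun S hS => mul_le_mul_of_nonneg_left (hh S (Finset.mem_powerset.1 hS)) ?_
  have : 0 ≤ 1 - p := by linarith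
  positivity

lemma Ex_add (p : ℝ) (A : Finset ι) (h h' : Finset ι → ℝ) :
    Ex p A (fun S => h S + h' S) = Ex p A h + Ex p A h' := by
  unfold Ex
  rw [← Finset.sum_add_distrib]
  exact Finset.sum_congr rfl fun S _ => by ring

lemma Ex_mul (p : ℝ) (A : Finset ι) (c : ℝ) (h : Finset ι → ℝ) :
    Ex p A (fun S => c * h S) = c * Ex p A h := by
  unfold Ex
  rw [Finset.mul_sum]
  exact Finset.sum_congr rfl fun S _ => by ring

lemma Ex_sum {κ : Type*} (p : ℝ) (A : Finset ι) (s : Finset κ) (h : κ → Finset ι → ℝ) :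
    Ex p A (fun S => ∑ k ∈ s, h k S) = ∑ k ∈ s, Ex p A (h k) := by
  unfold Ex
  simp_rw [Finset.mul_sum]
  rw [Finset.sum_comm]

lemma Ex_const (p : ℝ) (A : Finset ι) (c : ℝ) : Ex p A (fun _ => c) = c := by
  induction A using Finset.induction_on with
  | empty => rw [Ex_empty]
  | insert a A ha ih => rw [Ex_insert p ha, ih]; ring

lemma Ex_card (p : ℝ) (A : Finset ι) : Ex p A (fun S => (#S : ℝ)) = #A * p := by
  induction A using Finset.induction_on with
  | empty => rw [Ex_empty]; simp
  | insert a A ha ih =>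
    have h2 : Ex p A (fun S => (#(insert a S) : ℝ)) = Ex p A (fun S => (#S : ℝ) + 1) := by
      unfold Ex
      refine Finset.sum_congr rfl fun S hS => ?_
      have haS : a ∉ S := fun h => ha (Finset.mem_powerset.1 hS h)
      dsimp only
      rw [Finset.card_insert_of_notMem haS]; push_cast; ring
    rw [Ex_insert p ha, h2, Ex_add, Ex_const, ih, Finset.card_insert_of_notMem ha]
    push_cast; ring

lemma Ex_congr (p : ℝ) (A : Finset ι) {h h' : Finset ι → ℝ}
    (hh : ∀ S, S ⊆ A → h S = h' S) : Ex p A h = Ex p A h' := by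
  unfold Ex
  exact Finset.sum_congr rfl fun S hS => by rw [hh S (Finset.mem_powerset.1 hS)]

lemma Ex_comp (p q : ℝ) (A : Finset ι) : ∀ h : Finset ι → ℝ,
    Ex (q * p) A h = Ex p A (fun S => Ex q S h) := by
  induction A using Finset.induction_on with
  | empty => intro h; simp [Ex_empty]
  | insert a A ha ih =>
    intro h
    have h2 : Ex p A (fun S => Ex q (insert a S) h) =
        Ex p A (fun S => (1 - q) * Ex q S h + q * Ex q S (fun S => h (insert a S))) :=
      Ex_congr _ _ fun S hS => Ex_insert q (fun h => ha (hS h)) h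
    rw [Ex_insert _ ha, Ex_insert _ ha, h2, Ex_add, Ex_mul, Ex_mul, ← ih, ← ih]
    ring

lemma Ex_submod {q : ℝ} (hq0 : 0 ≤ q) (hq1 : q ≤ 1) (h : Finset ι → ℝ) (h0 : 0 ≤ h ∅)
    (hs : ∀ (T S : Finset ι) (a : ι), T ⊆ S → a ∉ S →
      h (insert a S) - h S ≤ h (insert a T) - h T) (A : Finset ι) :
    q * h A ≤ Ex q A h := by
  induction A using Finset.induction_on with
  | empty => rw [Ex_empty]; nlinarith
  | insert a A ha ih =>
    have h2 : Ex q A (fun S => h S + (h (insert a A) - h A)) ≤ Ex q A (fun S => h (insert a S)) :=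
      Ex_mono hq0 hq1 A fun S hS => by linarith [hs S A a hS ha]
    rw [Ex_add, Ex_const] at h2
    rw [Ex_insert _ ha]
    nlinarith

lemma Ex_thin {p1 p2 : ℝ} (h2 : 0 ≤ p2) (h12 : p2 ≤ p1) (h1 : p1 ≤ 1) (h : Finset ι → ℝ)
    (h0 : 0 ≤ h ∅)
    (hs : ∀ (T S : Finset ι) (a : ι), T ⊆ S → a ∉ S →
      h (insert a S) - h S ≤ h (insert a T) - h T) (A : Finset ι) :
    p2 * Ex p1 A h ≤ p1 * Ex p2 A h := by
  rcases eq_or_lt_of_le (h2.trans h12) with hp | hp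
  · have : p2 = 0 := by linarith
    rw [this, ← hp]
  · have hq : p2 = p2 / p1 * p1 := by field_simp
    have hq0 : 0 ≤ p2 / p1 := by positivity
    have hq1 : p2 / p1 ≤ 1 := by rw [div_le_one hp]; exact h12
    have key : p2 / p1 * Ex p1 A h ≤ Ex p2 A h := by
      conv_rhs => rw [hq, Ex_comp]
      rw [← Ex_mul]
      exact Ex_mono hp.le h1 A fun S _ => Ex_submod hq0 hq1 h h0 hs S
    calc p2 * Ex p1 A h = p1 * (p2 / p1 * Ex p1 A h) := by field_simp
      _ ≤ _ := mul_le_mul_of_nonneg_left key hp.le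

lemma Ex_anti {p1 p2 : ℝ} (h2 : 0 ≤ p2) (h12 : p2 ≤ p1) (h1 : p1 ≤ 1) (h : Finset ι → ℝ)
    (hs : ∀ (T S : Finset ι), T ⊆ S → h S ≤ h T) (A : Finset ι) :
    Ex p1 A h ≤ Ex p2 A h := by
  rcases eq_or_lt_of_le (h2.trans h12) with hp | hp
  · have : p2 = 0 := by linarith
    rw [this, ← hp]
  · have hq : p2 = p2 / p1 * p1 := by field_simp
    have hq0 : 0 ≤ p2 / p1 := by positivity
    have hq1 : p2 / p1 ≤ 1 := by rw [div_le_one hp]; exact h12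
    conv_rhs => rw [hq, Ex_comp]
    refine Ex_mono hp.le h1 A fun S _ => ?_
    calc h S = Ex (p2 / p1) S (fun _ => h S) := (Ex_const _ _ _).symm
      _ ≤ _ := Ex_mono hq0 hq1 S fun T hT => hs T S hT

lemma Ex_pow (p c : ℝ) (B A : Finset ι) :
    Ex p A (fun S => c ^ #(S ∩ B)) = (p * c + (1 - p)) ^ #(A ∩ B) := by
  induction A using Finset.induction_on with
  | empty => rw [Ex_empty]; simp
  | insert a A ha ih =>
    rw [Ex_insert p ha, ih]
    by_cases hB : a ∈ B
    · have h2 : Ex p A (fun S => c ^ #(insert a S ∩ B)) = Ex p A (fun S => c * c ^ #(S ∩ B)) := by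
        refine Ex_congr _ _ fun S hS => ?_
        have haS : a ∉ S := fun h => ha (hS h)
        rw [Finset.insert_inter_of_mem hB, Finset.card_insert_of_notMem (by simp [haS])]
        ring
      rw [h2, Ex_mul, ih, Finset.insert_inter_of_mem hB,
        Finset.card_insert_of_notMem (by simp [ha])]
      ring
    · simp_rw [Finset.insert_inter_of_notMem hB]
      rw [ih]; ring

end Expectation

section ChannelSums

/-- Erasing the coordinates outside `S`. -/
def mask {n : ℕ} (S : Finset (Fin n)) (x : Fin n → Bool) : Fin n → Option Bool :=
  fun t => if t ∈ S then some (x t) else none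

lemma bec_sum (e : ℝ) {n : ℕ} (x : Fin n → Bool) (φ : (Fin n → Option Bool) → ℝ) :
    ∑ y : Fin n → Option Bool, (∏ t, BECk e (x t) (y t)) * φ y
      = Ex (1 - e) univ (fun S => φ (mask S x)) := by
  have h1 : ∀ y : Fin n → Option Bool, (∏ t, BECk e (x t) (y t)) =
      ∑ S ∈ (univ : Finset (Fin n)).powerset,
        (1 - e) ^ #S * e ^ #(univ \ S) * (if y = mask S x then 1 else 0) := by
    intro y
    have h2 : ∀ t, BECk e (x t) (y t) =
        (1 - e) * (if y t = some (x t) then 1 else 0) + e * (if y t = none then 1 else 0) := by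
      intro t
      unfold BECk
      cases hy : y t with
      | none => simp
      | some b => simp
    simp_rw [h2]
    rw [Finset.prod_add]
    refine Finset.sum_congr rfl fun S _ => ?_
    simp_rw [Finset.prod_mul_distrib, Finset.prod_const]
    by_cases hy : y = mask S x
    · have e1 : ∏ i ∈ S, (if y i = some (x i) then (1:ℝ) else 0) = 1 :=
        Finset.prod_eq_one fun i hi => by simp [hy, mask, hi]
      have e2 : ∏ i ∈ univ \ S, (if y i = none then (1:ℝ) else 0) = 1 :=
        Finset.prod_eq_one fun i hi => by
          have : i ∉ S := (Finset.mem_sdiff.1 hi).2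
          simp [hy, mask, this]
      rw [e1, e2, if_pos hy]; ring
    · rw [if_neg hy]
      obtain ⟨t, ht⟩ := Function.ne_iff.1 hy
      by_cases hS : t ∈ S
      · have e1 : ∏ i ∈ S, (if y i = some (x i) then (1:ℝ) else 0) = 0 :=
          Finset.prod_eq_zero hS (by simpa [mask, hS] using ht)
        rw [e1]; ring
      · have e2 : ∏ i ∈ univ \ S, (if y i = none then (1:ℝ) else 0) = 0 :=
          Finset.prod_eq_zero (i := t) (by simp [hS]) (by simpa [mask, hS] using ht)
        rw [e2]; ring
  simp_rw [h1, Finset.sum_mul]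
  rw [Finset.sum_comm]
  unfold Ex
  refine Finset.sum_congr rfl fun S _ => ?_
  rw [Finset.sum_eq_single (mask S x)]
  · simp
  · intro y _ hy; simp [hy]
  · simp

variable (e1 e2 : ℝ) (W : Bool → Option Bool × Option Bool → ℝ)

lemma nFold_sum1 (hm1 : ∀ x y, margW1 W x y = BECk e1 x y) {n : ℕ} (x : Fin n → Bool)
    (φ : (Fin n → Option Bool) → ℝ) :
    ∑ y : (Fin n → Option Bool) × (Fin n → Option Bool), nFold W n x y * φ y.1
      = Ex (1 - e1) univ (fun S => φ (mask S x)) := by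
  rw [← bec_sum, Fintype.sum_prod_type]
  refine Finset.sum_congr rfl fun y _ => ?_
  dsimp only
  rw [← Finset.sum_mul]
  congr 1
  simp_rw [← hm1, margW1, nFold]
  rw [Finset.prod_univ_sum]
  simp

lemma nFold_sum2 (hm2 : ∀ x y, margW2 W x y = BECk e2 x y) {n : ℕ} (x : Fin n → Bool)
    (φ : (Fin n → Option Bool) → ℝ) :
    ∑ y : (Fin n → Option Bool) × (Fin n → Option Bool), nFold W n x y * φ y.2
      = Ex (1 - e2) univ (fun S => φ (mask S x)) := by
  rw [← bec_sum, Fintype.sum_prod_type_right]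
  refine Finset.sum_congr rfl fun y _ => ?_
  dsimp only
  rw [← Finset.sum_mul]
  congr 1
  simp_rw [← hm2, margW2, nFold]
  rw [Finset.prod_univ_sum]
  simp

lemma nFold_nonneg (hW : IsChannel W) {n : ℕ} (x : Fin n → Bool)
    (y : (Fin n → Option Bool) × (Fin n → Option Bool)) : 0 ≤ nFold W n x y :=
  Finset.prod_nonneg fun _ _ => (hW _).1 _

end ChannelSums

section Entropy

variable {Ω : Type} [Fintype Ω]

/-- Size of the class of `ω` under `Z`. -/
def cls {α : Type} (Z : Ω → α) (ω : Ω) : ℝ := ∑ ω', if Z ω' = Z ω then (1:ℝ) else 0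

/-- Sum of logarithms of class sizes. -/
def Lg {α : Type} (Z : Ω → α) : ℝ := ∑ ω, Real.log (cls Z ω)

lemma cls_pos {α : Type} (Z : Ω → α) (ω : Ω) : 1 ≤ cls Z ω := by
  unfold cls
  calc (1:ℝ) = if Z ω = Z ω then (1:ℝ) else 0 := by simp
    _ ≤ _ := Finset.single_le_sum (f := fun ω' => if Z ω' = Z ω then (1:ℝ) else 0)
      (fun i _ => by positivity) (Finset.mem_univ ω)

lemma cls_mono {α β : Type} (Z : Ω → α) (Y : Ω → β) (h : ∀ ω ω', Y ω = Y ω' → Z ω = Z ω')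
    (ω : Ω) : cls Y ω ≤ cls Z ω := by
  unfold cls
  refine Finset.sum_le_sum fun ω' _ => ?_
  by_cases hy : Y ω' = Y ω
  · simp [hy, h _ _ hy]
  · rw [if_neg hy]; positivity

lemma Lg_mono {α β : Type} (Z : Ω → α) (Y : Ω → β) (h : ∀ ω ω', Y ω = Y ω' → Z ω = Z ω') :
    Lg Y ≤ Lg Z :=
  Finset.sum_le_sum fun ω _ => Real.log_le_log (by linarith [cls_pos Y ω]) (cls_mono Z Y h ω)

lemma Lg_congr {α β : Type} (Z : Ω → α) (Y : Ω → β) (h : ∀ ω ω', Y ω = Y ω' ↔ Z ω = Z ω') :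
    Lg Y = Lg Z :=
  le_antisymm (Lg_mono _ _ fun a b => (h a b).1) (Lg_mono _ _ fun a b => (h a b).2)

lemma class_sum {α : Type} (Z : Ω → α) (P : Ω → Prop) [DecidablePred P]
    (hP : ∀ ω ω', P ω → P ω' → Z ω = Z ω') :
    ∑ ω, (if P ω then 1 / cls Z ω else 0) ≤ 1 := by
  by_cases h : ∃ ω0, P ω0
  · obtain ⟨ω0, h0⟩ := h
    have hc : (0:ℝ) < cls Z ω0 := by linarith [cls_pos Z ω0]
    calc ∑ ω, (if P ω then 1 / cls Z ω else 0)
        ≤ ∑ ω, (if Z ω = Z ω0 then (1:ℝ) else 0) * (1 / cls Z ω0) := by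
          refine Finset.sum_le_sum fun ω _ => ?_
          by_cases hω : P ω
          · have he := hP ω ω0 hω h0
            simp [hω, he, cls]
          · rw [if_neg hω]; positivity
      _ = 1 := by
        rw [← Finset.sum_mul]
        change cls Z ω0 * (1 / cls Z ω0) = 1
        field_simp
  · push Not at h
    simp [h]

lemma ratio_sum {α γ : Type} (Z : Ω → α) (Y : Ω → γ) (Q : Ω → Prop) [DecidablePred Q] (c : ℝ)
    (h : ∀ ω', ∑ ω, (if Q ω ∧ Z ω' = Z ω then 1 / cls Y ω else 0) ≤ c) :
    ∑ ω, (if Q ω then cls Z ω / cls Y ω else 0) ≤ c * Fintype.card Ω := by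
  calc ∑ ω, (if Q ω then cls Z ω / cls Y ω else 0)
      = ∑ ω, ∑ ω', (if Q ω ∧ Z ω' = Z ω then 1 / cls Y ω else 0) := by
        refine Finset.sum_congr rfl fun ω _ => ?_
        by_cases hQ : Q ω
        · simp only [hQ, if_true, true_and]
          conv_lhs => rw [cls, Finset.sum_div]
          exact Finset.sum_congr rfl fun ω' _ => by split_ifs <;> simp
        · simp [hQ]
    _ = ∑ ω', ∑ ω, (if Q ω ∧ Z ω' = Z ω then 1 / cls Y ω else 0) := Finset.sum_comm
    _ ≤ ∑ _ω' : Ω, c := Finset.sum_le_sum fun ω' _ => h ω'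
    _ = _ := by simp [mul_comm]

lemma ratio_bound {α β γ : Type} [Fintype β] (Z : Ω → α) (Y : Ω → γ) (V : Ω → β) (Q : Ω → Prop)
    [DecidablePred Q]
    (hY : ∀ ω ω', Z ω = Z ω' → V ω = V ω' → Y ω = Y ω') :
    ∑ ω, (if Q ω then cls Z ω / cls Y ω else 0) ≤ Fintype.card β * Fintype.card Ω := by
  refine ratio_sum Z Y Q _ fun ω' => ?_
  calc ∑ ω, (if Q ω ∧ Z ω' = Z ω then 1 / cls Y ω else 0)
      ≤ ∑ ω, ∑ v : β, (if Z ω' = Z ω ∧ V ω = v then 1 / cls Y ω else 0) := by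
        refine Finset.sum_le_sum fun ω _ => ?_
        have hc : (0:ℝ) < cls Y ω := by linarith [cls_pos Y ω]
        by_cases hZ : Z ω' = Z ω
        · simp only [hZ, true_and, and_true]
          rw [Finset.sum_ite_eq]
          simp only [Finset.mem_univ, if_true]
          split_ifs
          · exact le_rfl
          · positivity
        · simp [hZ]
    _ = ∑ v : β, ∑ ω, (if Z ω' = Z ω ∧ V ω = v then 1 / cls Y ω else 0) := Finset.sum_comm
    _ ≤ ∑ _v : β, (1:ℝ) := Finset.sum_le_sum fun v _ =>
        class_sum Y (fun ω => Z ω' = Z ω ∧ V ω = v) fun a b ha hb =>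
          hY a b (ha.1.symm.trans hb.1) (ha.2.trans hb.2.symm)
    _ = _ := by simp

lemma log_ratio {α γ : Type} (Z : Ω → α) (Y : Ω → γ) :
    Lg Z - Lg Y = ∑ ω, Real.log (cls Z ω / cls Y ω) := by
  unfold Lg
  rw [← Finset.sum_sub_distrib]
  refine Finset.sum_congr rfl fun ω _ => ?_
  rw [Real.log_div] <;> [linarith [cls_pos Z ω]; linarith [cls_pos Y ω]]

lemma log_le_lin {x K : ℝ} (hx : 0 < x) (hK : 0 < K) : Real.log x ≤ x / K - 1 + Real.log K := by
  have := Real.log_le_sub_one_of_pos (div_pos hx hK)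
  rw [Real.log_div hx.ne' hK.ne'] at this
  linarith

lemma ent_card {α β γ : Type} [Fintype β] [Nonempty β] (Z : Ω → α) (Y : Ω → γ) (V : Ω → β)
    (hY : ∀ ω ω', Z ω = Z ω' → V ω = V ω' → Y ω = Y ω') :
    Lg Z - Lg Y ≤ Fintype.card Ω * Real.log (Fintype.card β) := by
  have hK : (0:ℝ) < Fintype.card β := by exact_mod_cast Fintype.card_pos
  have hb := ratio_bound Z Y V (fun _ => True) hY
  simp only [if_true] at hb
  rw [log_ratio]
  calc ∑ ω, Real.log (cls Z ω / cls Y ω)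
      ≤ ∑ ω, (cls Z ω / cls Y ω / Fintype.card β - 1 + Real.log (Fintype.card β)) :=
        Finset.sum_le_sum fun ω _ => log_le_lin
          (div_pos (by linarith [cls_pos Z ω]) (by linarith [cls_pos Y ω])) hK
    _ = (∑ ω, cls Z ω / cls Y ω) / Fintype.card β - Fintype.card Ω
          + Fintype.card Ω * Real.log (Fintype.card β) := by
        rw [Finset.sum_add_distrib, Finset.sum_sub_distrib, Finset.sum_div]; simp
    _ ≤ _ := by
        have : (∑ ω, cls Z ω / cls Y ω) / Fintype.card β ≤ Fintype.card Ω := by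
          rw [div_le_iff₀ hK]; linarith
        linarith

lemma fano {α β γ : Type} [Fintype β] [Nonempty β] (Z : Ω → α) (Y : Ω → γ) (V : Ω → β)
    (hY : ∀ ω ω', Z ω = Z ω' → V ω = V ω' → Y ω = Y ω') (g : α → β) {a : ℝ} (ha : 1 ≤ a) :
    Lg Z - Lg Y ≤ (∑ ω, if g (Z ω) = V ω then (0:ℝ) else 1) *
      (Real.log (Fintype.card β) + Real.log a) + Fintype.card Ω / a := by
  have hK : (0:ℝ) < Fintype.card β := by exact_mod_cast Fintype.card_pos
  have ha0 : (0:ℝ) < a := by linarith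
  have hb := ratio_bound Z Y V (fun ω => ¬ (g (Z ω) = V ω)) hY
  have hg := ratio_sum Z Y (fun ω => g (Z ω) = V ω) 1 (fun ω' =>
    class_sum Y (fun ω => g (Z ω) = V ω ∧ Z ω' = Z ω) fun a b ha hb => hY a b (ha.2.symm.trans hb.2)
      (by rw [← ha.1, ← hb.1, ← ha.2, ← hb.2]))
  have hcount : (∑ ω, if g (Z ω) = V ω then (1:ℝ) else 0)
      + (∑ ω, if g (Z ω) = V ω then (0:ℝ) else 1) = Fintype.card Ω := by
    rw [← Finset.sum_add_distrib]
    rw [Finset.sum_congr rfl (g := fun _ => (1:ℝ)) (fun ω _ => by split_ifs <;> simp)]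
    simp
  set B := ∑ ω, if g (Z ω) = V ω then (0:ℝ) else 1 with hB
  set G := ∑ ω, if g (Z ω) = V ω then (1:ℝ) else 0 with hG
  have hB0 : 0 ≤ B := Finset.sum_nonneg fun ω _ => by positivity
  have hlK : Real.log (Fintype.card β * a) = Real.log (Fintype.card β) + Real.log a :=
    Real.log_mul hK.ne' ha0.ne'
  rw [log_ratio]
  calc ∑ ω, Real.log (cls Z ω / cls Y ω)
      ≤ ∑ ω, ((if g (Z ω) = V ω then cls Z ω / cls Y ω else 0)
          - (if g (Z ω) = V ω then (1:ℝ) else 0)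
          + (if ¬ (g (Z ω) = V ω) then cls Z ω / cls Y ω else 0) / (Fintype.card β * a)
          + (if g (Z ω) = V ω then (0:ℝ) else 1)
            * (Real.log (Fintype.card β) + Real.log a - 1)) := by
        refine Finset.sum_le_sum fun ω _ => ?_
        have hx : 0 < cls Z ω / cls Y ω :=
          div_pos (by linarith [cls_pos Z ω]) (by linarith [cls_pos Y ω])
        by_cases h : g (Z ω) = V ω
        · simp only [h, if_true, not_true, if_false]
          have := Real.log_le_sub_one_of_pos hx
          simpa using this
        · simp only [h, if_false, not_false_iff, if_true]
          have := log_le_lin hx (mul_pos hK ha0)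
          rw [hlK] at this
          linarith
    _ = (∑ ω, if g (Z ω) = V ω then cls Z ω / cls Y ω else 0) - G
          + (∑ ω, if ¬ (g (Z ω) = V ω) then cls Z ω / cls Y ω else 0) / (Fintype.card β * a)
          + B * (Real.log (Fintype.card β) + Real.log a - 1) := by
        rw [Finset.sum_add_distrib, Finset.sum_add_distrib, Finset.sum_sub_distrib,
          Finset.sum_div, Finset.sum_mul]
    _ ≤ _ := by
        have h2 : (∑ ω, if ¬ (g (Z ω) = V ω) then cls Z ω / cls Y ω else 0) / (Fintype.card β * a)
            ≤ Fintype.card Ω / a := by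
          rw [div_le_div_iff₀ (by positivity) ha0]
          have := mul_le_mul_of_nonneg_right hb ha0.le
          linarith
        nlinarith

lemma ent_submod {α β γ δ : Type} (A : Ω → α) (B : Ω → β) (Y : Ω → γ) (C : Ω → δ)
    (hA : ∀ ω ω', A ω = A ω' → C ω = C ω') (hB : ∀ ω ω', B ω = B ω' → C ω = C ω')
    (hY : ∀ ω ω', A ω = A ω' → B ω = B ω' → Y ω = Y ω') :
    Lg A + Lg B ≤ Lg Y + Lg C := by
  have key : ∑ ω, cls A ω * cls B ω / (cls Y ω * cls C ω) ≤ Fintype.card Ω := by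
    calc ∑ ω, cls A ω * cls B ω / (cls Y ω * cls C ω)
        = ∑ ω, ∑ ω', ∑ ω'', (if A ω = A ω' ∧ B ω = B ω'' then 1 / cls Y ω else 0)
            * (if A ω = A ω' ∧ B ω = B ω'' then 1 / cls C ω else 0) := by
          refine Finset.sum_congr rfl fun ω _ => ?_
          have : cls A ω * cls B ω = ∑ ω', ∑ ω'', (if A ω = A ω' ∧ B ω = B ω'' then (1:ℝ) else 0) := by
            unfold cls
            rw [Finset.sum_mul_sum]
            refine Finset.sum_congr rfl fun ω' _ => Finset.sum_congr rfl fun ω'' _ => ?_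
            rw [eq_comm (a := A ω'), eq_comm (a := B ω'')]
            by_cases h1 : A ω = A ω' <;> by_cases h2 : B ω = B ω'' <;> simp [h1, h2]
          rw [this, Finset.sum_div]
          refine Finset.sum_congr rfl fun ω' _ => ?_
          rw [Finset.sum_div]
          refine Finset.sum_congr rfl fun ω'' _ => ?_
          split_ifs <;> simp [mul_comm]
      _ ≤ ∑ ω, ∑ ω', ∑ ω'', (if A ω = A ω' ∧ B ω = B ω'' then 1 / cls Y ω else 0)
            * (if C ω'' = C ω' then 1 / cls C ω' else 0) := by
          refine Finset.sum_le_sum fun ω _ => Finset.sum_le_sum fun ω' _ =>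
            Finset.sum_le_sum fun ω'' _ => ?_
          by_cases h : A ω = A ω' ∧ B ω = B ω''
          · have h1 := hA _ _ h.1
            have h2 := hB _ _ h.2
            have h3 : C ω'' = C ω' := h2.symm.trans h1
            have h4 : cls C ω = cls C ω' := by unfold cls; rw [h1]
            rw [if_pos h, if_pos h, if_pos h3, h4]
          · simp [h]
      _ = ∑ ω', ∑ ω'', (∑ ω, (if A ω = A ω' ∧ B ω = B ω'' then 1 / cls Y ω else 0))
            * (if C ω'' = C ω' then 1 / cls C ω' else 0) := by
          rw [Finset.sum_comm]
          refine Finset.sum_congr rfl fun ω' _ => ?_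
          rw [Finset.sum_comm]
          refine Finset.sum_congr rfl fun ω'' _ => ?_
          rw [Finset.sum_mul]
      _ ≤ ∑ ω', ∑ ω'', 1 * (if C ω'' = C ω' then 1 / cls C ω' else 0) := by
          refine Finset.sum_le_sum fun ω' _ => Finset.sum_le_sum fun ω'' _ => ?_
          refine mul_le_mul_of_nonneg_right ?_ ?_
          · exact class_sum Y (fun ω => A ω = A ω' ∧ B ω = B ω'') fun a b ha hb =>
              hY a b (ha.1.trans hb.1.symm) (ha.2.trans hb.2.symm)
          · have : 0 < cls C ω' := by linarith [cls_pos C ω']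
            positivity
      _ = ∑ _ω' : Ω, (1:ℝ) := by
          refine Finset.sum_congr rfl fun ω' _ => ?_
          have : 0 < cls C ω' := by linarith [cls_pos C ω']
          calc ∑ ω'', 1 * (if C ω'' = C ω' then 1 / cls C ω' else 0)
              = cls C ω' * (1 / cls C ω') := by
                conv_rhs => rw [cls, Finset.sum_mul]
                refine Finset.sum_congr rfl fun ω'' _ => ?_
                split_ifs <;> simp [cls]
            _ = 1 := by field_simp
      _ = _ := by simp
  have h : ∑ ω, (Real.log (cls A ω) + Real.log (cls B ω) - Real.log (cls Y ω) - Real.log (cls C ω))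
      ≤ ∑ ω, (cls A ω * cls B ω / (cls Y ω * cls C ω) - 1) := by
    refine Finset.sum_le_sum fun ω _ => ?_
    have a1 : 0 < cls A ω := by linarith [cls_pos A ω]
    have a2 : 0 < cls B ω := by linarith [cls_pos B ω]
    have a3 : 0 < cls Y ω := by linarith [cls_pos Y ω]
    have a4 : 0 < cls C ω := by linarith [cls_pos C ω]
    have := Real.log_le_sub_one_of_pos (div_pos (mul_pos a1 a2) (mul_pos a3 a4))
    rw [Real.log_div (by positivity) (by positivity), Real.log_mul a1.ne' a2.ne',
      Real.log_mul a3.ne' a4.ne'] at this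
    linarith
  simp only [Finset.sum_sub_distrib, Finset.sum_add_distrib] at h
  simp only [Finset.sum_const, Finset.card_univ, nsmul_eq_mul, mul_one] at h
  unfold Lg
  linarith

end Entropy

section Converse

lemma mask_eq_iff {n : ℕ} (S : Finset (Fin n)) (x x' : Fin n → Bool) :
    mask S x = mask S x' ↔ ∀ t ∈ S, x t = x' t := by
  unfold mask
  constructor
  · intro h t ht
    have := congrFun h t
    simpa [ht] using this
  · intro h
    funext t
    by_cases ht : t ∈ S
    · simp [ht, h t ht]
    · simp [ht]

lemma Lg_inj {Ω α : Type} [Fintype Ω] (Z : Ω → α) (h : ∀ ω ω', Z ω = Z ω' → ω = ω') :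
    Lg Z = 0 := by
  unfold Lg
  refine Finset.sum_eq_zero fun ω _ => ?_
  have : cls Z ω = 1 := by
    unfold cls
    rw [Finset.sum_eq_single ω]
    · simp
    · intro b _ hb
      rw [if_neg (fun h' => hb (h _ _ h'))]
    · simp
  rw [this, Real.log_one]

lemma Lg_const {Ω : Type} [Fintype Ω] :
    Lg (fun _ : Ω => ()) = Fintype.card Ω * Real.log (Fintype.card Ω) := by
  simp [Lg, cls]

lemma ind_sum {α : Type} [Fintype α] (x : α) : ∑ y, (if y = x then (1:ℝ) else 0) = 1 := by
  rw [Finset.sum_eq_single x]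
  · simp
  · intro b _ hb
    rw [if_neg hb]
  · simp

lemma Lg_snd (k1 k2 : ℕ) : Lg (fun m : Fin k1 × Fin k2 => m.2) = (k1 * k2 : ℝ) * Real.log k1 := by
  have h : ∀ m : Fin k1 × Fin k2, cls (fun m : Fin k1 × Fin k2 => m.2) m = k1 := fun m => by
    unfold cls
    rw [Fintype.sum_prod_type]
    simp only [ind_sum]
    simp
  unfold Lg
  simp only [h]
  simp

lemma Lg_fst (k1 k2 : ℕ) : Lg (fun m : Fin k1 × Fin k2 => m.1) = (k1 * k2 : ℝ) * Real.log k2 := by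
  have h : ∀ m : Fin k1 × Fin k2, cls (fun m : Fin k1 × Fin k2 => m.1) m = k2 := fun m => by
    unfold cls
    rw [Fintype.sum_prod_type_right]
    simp only [ind_sum]
    simp
  unfold Lg
  simp only [h]
  simp

lemma mask_card {Ω α : Type} [Fintype Ω] {n : ℕ} (f : Ω → Fin n → Bool) (U : Ω → α)
    (S : Finset (Fin n)) :
    Lg U - Lg (fun ω => (U ω, mask S (f ω))) ≤ #S * (Fintype.card Ω * Real.log 2) := by
  induction S using Finset.induction_on with
  | empty =>
    have : Lg (fun ω => (U ω, mask ∅ (f ω))) = Lg U := Lg_congr _ _ fun a b => by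
      simp [mask_eq_iff]
    simp [this]
  | insert a S ha ih =>
    have h := ent_card (fun ω => (U ω, mask S (f ω))) (fun ω => (U ω, mask (insert a S) (f ω)))
      (fun ω => f ω a) (by
        intro ω ω' h1 h2
        simp only [Prod.mk.injEq, mask_eq_iff, Finset.mem_insert] at h1 ⊢
        refine ⟨h1.1, ?_⟩
        rintro t (rfl | ht)
        · exact h2
        · exact h1.2 t ht)
    rw [Finset.card_insert_of_notMem ha]
    simp only [Fintype.card_bool] at h
    push_cast at h ⊢
    linarith

lemma mask_submod {Ω α : Type} [Fintype Ω] {n : ℕ} (f : Ω → Fin n → Bool) (U : Ω → α)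
    (T S : Finset (Fin n)) (a : Fin n) (hTS : T ⊆ S) :
    Lg (fun ω => (U ω, mask S (f ω))) - Lg (fun ω => (U ω, mask (insert a S) (f ω))) ≤
    Lg (fun ω => (U ω, mask T (f ω))) - Lg (fun ω => (U ω, mask (insert a T) (f ω))) := by
  have := ent_submod (fun ω => (U ω, mask S (f ω))) (fun ω => (U ω, mask (insert a T) (f ω)))
    (fun ω => (U ω, mask (insert a S) (f ω))) (fun ω => (U ω, mask T (f ω)))
    (by
      intro ω ω' h
      simp only [Prod.mk.injEq, mask_eq_iff] at h ⊢
      exact ⟨h.1, fun t ht => h.2 t (hTS ht)⟩)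
    (by
      intro ω ω' h
      simp only [Prod.mk.injEq, mask_eq_iff, Finset.mem_insert] at h ⊢
      exact ⟨h.1, fun t ht => h.2 t (Or.inr ht)⟩)
    (by
      intro ω ω' h h'
      simp only [Prod.mk.injEq, mask_eq_iff, Finset.mem_insert] at h h' ⊢
      refine ⟨h.1, ?_⟩
      rintro t (rfl | ht)
      · exact h'.2 _ (Or.inl rfl)
      · exact h.2 t ht)
  linarith

/-- Generic error probability. -/
def errG (W : Bool → Option Bool × Option Bool → ℝ) (n k1 k2 : ℕ)
    (f : Fin k1 × Fin k2 → Fin n → Bool)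
    (a b : (Fin n → Option Bool) → Fin k1 × Fin k2 → Prop) : ℝ :=
  (1 : ℝ) / ((k1 : ℝ) * (k2 : ℝ)) *
    ∑ m : Fin k1 × Fin k2, ∑ y : (Fin n → Option Bool) × (Fin n → Option Bool),
      nFold W n (f m) y * (if a y.1 m ∧ b y.2 m then 0 else 1)

variable {e1 e2 : ℝ} {W : Bool → Option Bool × Option Bool → ℝ}

lemma errG_lb1 (hW : IsChannel W) (hm1 : ∀ x y, margW1 W x y = BECk e1 x y)
    {n k1 k2 : ℕ} (h1 : 0 < k1) (h2 : 0 < k2) (f : Fin k1 × Fin k2 → Fin n → Bool)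
    (a b : (Fin n → Option Bool) → Fin k1 × Fin k2 → Prop) {ε : ℝ}
    (he : errG W n k1 k2 f a b ≤ ε) :
    Ex (1 - e1) univ (fun S => ∑ m, if a (mask S (f m)) m then (0:ℝ) else 1) ≤ (k1 * k2) * ε := by
  rw [Ex_sum]
  have hk : (0:ℝ) < (k1:ℝ) * k2 := by positivity
  unfold errG at he
  rw [one_div, inv_mul_le_iff₀ hk] at he
  refine le_trans (Finset.sum_le_sum fun m _ => ?_) he
  rw [← nFold_sum1 e1 W hm1 (f m) (fun y => if a y m then (0:ℝ) else 1)]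
  refine Finset.sum_le_sum fun y _ => mul_le_mul_of_nonneg_left ?_ (nFold_nonneg W hW _ _)
  by_cases h : a y.1 m <;> by_cases h' : b y.2 m <;> simp [h, h']

lemma errG_lb2 (hW : IsChannel W) (hm2 : ∀ x y, margW2 W x y = BECk e2 x y)
    {n k1 k2 : ℕ} (h1 : 0 < k1) (h2 : 0 < k2) (f : Fin k1 × Fin k2 → Fin n → Bool)
    (a b : (Fin n → Option Bool) → Fin k1 × Fin k2 → Prop) {ε : ℝ}
    (he : errG W n k1 k2 f a b ≤ ε) :
    Ex (1 - e2) univ (fun S => ∑ m, if b (mask S (f m)) m then (0:ℝ) else 1) ≤ (k1 * k2) * ε := by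
  rw [Ex_sum]
  have hk : (0:ℝ) < (k1:ℝ) * k2 := by positivity
  unfold errG at he
  rw [one_div, inv_mul_le_iff₀ hk] at he
  refine le_trans (Finset.sum_le_sum fun m _ => ?_) he
  rw [← nFold_sum2 e2 W hm2 (f m) (fun y => if b y m then (0:ℝ) else 1)]
  refine Finset.sum_le_sum fun y _ => mul_le_mul_of_nonneg_left ?_ (nFold_nonneg W hW _ _)
  by_cases h : a y.1 m <;> by_cases h' : b y.2 m <;> simp [h, h']

lemma errG_ub (hW : IsChannel W) (hm1 : ∀ x y, margW1 W x y = BECk e1 x y)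
    (hm2 : ∀ x y, margW2 W x y = BECk e2 x y)
    {n k1 k2 : ℕ} (f : Fin k1 × Fin k2 → Fin n → Bool)
    (a b : (Fin n → Option Bool) → Fin k1 × Fin k2 → Prop) :
    errG W n k1 k2 f a b ≤ 1 / ((k1:ℝ) * k2) *
      ((∑ m, Ex (1 - e1) univ (fun S => if a (mask S (f m)) m then (0:ℝ) else 1)) +
       ∑ m, Ex (1 - e2) univ (fun S => if b (mask S (f m)) m then (0:ℝ) else 1)) := by
  unfold errG
  refine mul_le_mul_of_nonneg_left ?_ (by positivity)
  rw [← Finset.sum_add_distrib]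
  refine Finset.sum_le_sum fun m _ => ?_
  rw [← nFold_sum1 e1 W hm1 (f m) (fun y => if a y m then (0:ℝ) else 1),
    ← nFold_sum2 e2 W hm2 (f m) (fun y => if b y m then (0:ℝ) else 1), ← Finset.sum_add_distrib]
  refine Finset.sum_le_sum fun y _ => ?_
  rw [← mul_add]
  refine mul_le_mul_of_nonneg_left ?_ (nFold_nonneg W hW _ _)
  by_cases h : a y.1 m <;> by_cases h' : b y.2 m <;> simp [h, h']

lemma errP1_eq (n k1 k2 : ℕ) (f : Fin k1 × Fin k2 → Fin n → Bool)
    (g1 : (Fin n → Option Bool) × Fin k2 → Fin k1) (g2 : (Fin n → Option Bool) → Fin k2) :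
    errP1 W n k1 k2 f g1 g2 =
      errG W n k1 k2 f (fun y m => g1 (y, m.2) = m.1) (fun y m => g2 y = m.2) := by
  unfold errP1 errG
  congr! 6

lemma errP2_eq (n k1 k2 : ℕ) (f : Fin k1 × Fin k2 → Fin n → Bool)
    (g1 : (Fin n → Option Bool) → Fin k1) (g2 : (Fin n → Option Bool) × Fin k1 → Fin k2) :
    errP2 W n k1 k2 f g1 g2 =
      errG W n k1 k2 f (fun y m => g1 y = m.1) (fun y m => g2 (y, m.1) = m.2) := by
  unfold errP2 errG
  congr! 6

lemma errP0_eq (n k1 k2 : ℕ) (f : Fin k1 × Fin k2 → Fin n → Bool)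
    (g1 : (Fin n → Option Bool) → Fin k1) (g2 : (Fin n → Option Bool) → Fin k2) :
    errP0 W n k1 k2 f g1 g2 =
      errG W n k1 k2 f (fun y m => g1 y = m.1) (fun y m => g2 y = m.2) := by
  unfold errP0 errG
  congr! 6

/-- Averaging the Fano inequality over the erasure pattern. -/
lemma fano_avg {p : ℝ} (hp0 : 0 ≤ p) (hp1 : p ≤ 1) {n k1 k2 k : ℕ} (hk : 0 < k)
    {a ε : ℝ} (ha : 1 ≤ a) (h B : Finset (Fin n) → ℝ)
    (hB : Ex p univ B ≤ (k1 * k2) * ε)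
    (hh : ∀ S, h S ≤ B S * (Real.log k + Real.log a) + (k1 * k2 : ℝ) / a) :
    Ex p univ h ≤ (k1 * k2) * (ε * (Real.log k + Real.log a) + 1 / a) := by
  have h1 : Ex p univ h ≤ Ex p univ (fun S => (Real.log k + Real.log a) * B S +
      (k1 * k2 : ℝ) / a) :=
    Ex_mono hp0 hp1 _ fun S _ => by linarith [hh S]
  rw [Ex_add, Ex_mul, Ex_const] at h1
  have hl : 0 ≤ Real.log k + Real.log a :=
    add_nonneg (Real.log_nonneg (by exact_mod_cast hk)) (Real.log_nonneg ha)
  have h2 := mul_le_mul_of_nonneg_left hB hl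
  calc _ ≤ _ := h1
    _ ≤ (Real.log k + Real.log a) * ((k1 * k2) * ε) + (k1 * k2 : ℝ) / a := by linarith
    _ = _ := by ring

lemma converse1 (he1 : 0 ≤ e1) (he12 : e1 ≤ e2) (he2 : e2 ≤ 1)
    (hW : IsChannel W) (hm1 : ∀ x y, margW1 W x y = BECk e1 x y)
    (hm2 : ∀ x y, margW2 W x y = BECk e2 x y)
    {n k1 k2 : ℕ} (h1 : 0 < k1) (h2 : 0 < k2) (f : Fin k1 × Fin k2 → Fin n → Bool)
    (g1 : (Fin n → Option Bool) × Fin k2 → Fin k1) (g2 : (Fin n → Option Bool) → Fin k2)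
    {a ε : ℝ} (ha : 1 ≤ a) (he : errP1 W n k1 k2 f g1 g2 ≤ ε) :
    Real.log k1 ≤ n * ((1 - e1) * Real.log 2) + (ε * (Real.log k1 + Real.log a) + 1 / a) ∧
    Real.log k2 ≤ n * ((1 - e2) * Real.log 2) + (ε * (Real.log k2 + Real.log a) + 1 / a) ∧
    (1 - e2) * Real.log k1 + (1 - e1) * Real.log k2 ≤ n * ((1 - e1) * (1 - e2) * Real.log 2)
      + (1 - e2) * (ε * (Real.log k1 + Real.log a) + 1 / a)
      + (1 - e1) * (ε * (Real.log k2 + Real.log a) + 1 / a) := by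
  rw [errP1_eq] at he
  have b1 := errG_lb1 hW hm1 h1 h2 f _ _ he
  have b2 := errG_lb2 hW hm2 h1 h2 f _ _ he
  have hk : (0:ℝ) < (k1:ℝ) * k2 := by positivity
  have : Nonempty (Fin k1) := ⟨⟨0, h1⟩⟩
  have : Nonempty (Fin k2) := ⟨⟨0, h2⟩⟩
  have hN : (Fintype.card (Fin k1 × Fin k2) : ℝ) = k1 * k2 := by simp
  set h : Finset (Fin n) → ℝ := fun S =>
    Lg (fun m : Fin k1 × Fin k2 => m.2) - Lg (fun m => (m.2, mask S (f m))) with hh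
  have hcard : ∀ S, h S ≤ #S * (k1 * k2 * Real.log 2) := fun S => by
    have := mask_card f (fun m : Fin k1 × Fin k2 => m.2) S
    rw [hN] at this; exact this
  have hnn : ∀ S, 0 ≤ h S := fun S => by
    have := Lg_mono (fun m : Fin k1 × Fin k2 => m.2) (fun m => (m.2, mask S (f m)))
      (fun ω ω' h => (Prod.mk.inj h).1)
    simp only [hh]; linarith
  have f1 : Ex (1 - e1) univ (fun S => (k1 * k2 : ℝ) * Real.log k1 + (-1) * h S) ≤
      (k1 * k2) * (ε * (Real.log k1 + Real.log a) + 1 / a) := by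
    refine fano_avg (by linarith) (by linarith) h1 ha _ _ b1 fun S => ?_
    have := fano (fun m => (mask S (f m), m.2)) (fun m => m) (fun m => m.1)
      (by
        intro ω ω' h h'
        exact Prod.ext h' (Prod.mk.inj h).2) g1 ha
    rw [Lg_inj _ (fun _ _ h => h), hN, Fintype.card_fin] at this
    have hc : Lg (fun m => (mask S (f m), m.2)) = Lg (fun m => (m.2, mask S (f m))) :=
      Lg_congr _ _ fun ω ω' => by simp [and_comm]
    rw [hc] at this
    simp only [hh, Lg_snd]
    convert this using 1
    · ring
  have f2 : Ex (1 - e2) univ (fun S => (k1 * k2 : ℝ) * Real.log k2 +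
        (h S + (-(k1 * k2 * Real.log 2)) * #S)) ≤
      (k1 * k2) * (ε * (Real.log k2 + Real.log a) + 1 / a) := by
    refine fano_avg (by linarith) (by linarith) h2 ha _ _ b2 fun S => ?_
    have := fano (fun m => mask S (f m)) (fun m => (m.2, mask S (f m))) (fun m => m.2)
      (by
        intro ω ω' h h'
        exact Prod.ext h' h) g2 ha
    rw [hN, Fintype.card_fin] at this
    have h3 := mask_card f (fun m : Fin k1 × Fin k2 => ()) S
    have hc : Lg (fun m : Fin k1 × Fin k2 => ((), mask S (f m))) = Lg (fun m => mask S (f m)) :=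
      Lg_congr _ _ fun ω ω' => by simp
    rw [hc, Lg_const, hN, Real.log_mul (by positivity) (by positivity)] at h3
    simp only [hh, Lg_snd]
    linarith
  rw [Ex_add, Ex_const, Ex_mul] at f1
  rw [Ex_add, Ex_const, Ex_add, Ex_mul, Ex_card, Finset.card_univ, Fintype.card_fin] at f2
  have hthin := Ex_thin (p1 := 1 - e1) (p2 := 1 - e2) (by linarith) (by linarith) (by linarith) h
    (hnn ∅) (fun T S a hTS _ => by
      have := mask_submod f (fun m : Fin k1 × Fin k2 => m.2) T S a hTS
      simp only [hh]; linarith) univ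
  have c1 : Ex (1 - e1) univ h ≤ n * (1 - e1) * (k1 * k2 * Real.log 2) := by
    have := Ex_mono (p := 1 - e1) (by linarith) (by linarith) univ (h := h)
      (h' := fun S => (k1 * k2 * Real.log 2) * #S) (fun S _ => by linarith [hcard S])
    rw [Ex_mul, Ex_card, Finset.card_univ, Fintype.card_fin] at this
    linarith
  have c2 : 0 ≤ Ex (1 - e2) univ h := by
    have := Ex_mono (p := 1 - e2) (by linarith) (by linarith) univ
      (h := fun _ => 0) (fun S _ => hnn S)
    rwa [Ex_const] at this
  refine ⟨?_, ?_, ?_⟩ <;> refine le_of_mul_le_mul_left ?_ hk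
  · linarith
  · linarith
  · have d1 := mul_le_mul_of_nonneg_left f1 (show 0 ≤ 1 - e2 by linarith)
    have d2 := mul_le_mul_of_nonneg_left f2 (show 0 ≤ 1 - e1 by linarith)
    linarith

lemma converse2 (he1 : 0 ≤ e1) (he12 : e1 ≤ e2) (he2 : e2 ≤ 1)
    (hW : IsChannel W) (hm1 : ∀ x y, margW1 W x y = BECk e1 x y)
    (hm2 : ∀ x y, margW2 W x y = BECk e2 x y)
    {n k1 k2 : ℕ} (h1 : 0 < k1) (h2 : 0 < k2) (f : Fin k1 × Fin k2 → Fin n → Bool)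
    (g1 : (Fin n → Option Bool) → Fin k1) (g2 : (Fin n → Option Bool) × Fin k1 → Fin k2)
    {a ε : ℝ} (ha : 1 ≤ a) (he : errP2 W n k1 k2 f g1 g2 ≤ ε) :
    Real.log k2 ≤ n * ((1 - e2) * Real.log 2) + (ε * (Real.log k2 + Real.log a) + 1 / a) ∧
    Real.log k1 + Real.log k2 ≤ n * ((1 - e1) * Real.log 2)
      + (ε * (Real.log k1 + Real.log a) + 1 / a)
      + (ε * (Real.log k2 + Real.log a) + 1 / a) := by
  rw [errP2_eq] at he
  have b1 := errG_lb1 hW hm1 h1 h2 f _ _ he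
  have b2 := errG_lb2 hW hm2 h1 h2 f _ _ he
  have hk : (0:ℝ) < (k1:ℝ) * k2 := by positivity
  have : Nonempty (Fin k1) := ⟨⟨0, h1⟩⟩
  have : Nonempty (Fin k2) := ⟨⟨0, h2⟩⟩
  have hN : (Fintype.card (Fin k1 × Fin k2) : ℝ) = k1 * k2 := by simp
  set h : Finset (Fin n) → ℝ := fun S => Lg (fun m => (m.1, mask S (f m))) with hh
  have f2 : Ex (1 - e2) univ h ≤ (k1 * k2) * (ε * (Real.log k2 + Real.log a) + 1 / a) := by
    refine fano_avg (by linarith) (by linarith) h2 ha _ _ b2 fun S => ?_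
    have := fano (fun m => (mask S (f m), m.1)) (fun m => m) (fun m => m.2)
      (by
        intro ω ω' h h'
        exact Prod.ext (Prod.mk.inj h).2 h') g2 ha
    rw [Lg_inj _ (fun _ _ h => h), hN, Fintype.card_fin] at this
    have hc : Lg (fun m => (mask S (f m), m.1)) = Lg (fun m => (m.1, mask S (f m))) :=
      Lg_congr _ _ fun ω ω' => by simp [and_comm]
    rw [hc, sub_zero] at this
    convert this using 1
  have f1 : Ex (1 - e1) univ (fun S => (k1 * k2 : ℝ) * (Real.log k1 + Real.log k2) +
        ((-1) * h S + (-(k1 * k2 * Real.log 2)) * #S)) ≤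
      (k1 * k2) * (ε * (Real.log k1 + Real.log a) + 1 / a) := by
    refine fano_avg (by linarith) (by linarith) h1 ha _ _ b1 fun S => ?_
    have := fano (fun m => mask S (f m)) (fun m => (m.1, mask S (f m))) (fun m => m.1)
      (by
        intro ω ω' h h'
        exact Prod.ext h' h) g1 ha
    rw [hN, Fintype.card_fin] at this
    have h3 := mask_card f (fun m : Fin k1 × Fin k2 => ()) S
    have hc : Lg (fun m : Fin k1 × Fin k2 => ((), mask S (f m))) = Lg (fun m => mask S (f m)) :=
      Lg_congr _ _ fun ω ω' => by simp
    rw [hc, Lg_const, hN, Real.log_mul (by positivity) (by positivity)] at h3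
    simp only [hh]
    linarith
  rw [Ex_add, Ex_const, Ex_add, Ex_mul, Ex_mul, Ex_card, Finset.card_univ, Fintype.card_fin] at f1
  have hanti := Ex_anti (p1 := 1 - e1) (p2 := 1 - e2) (by linarith) (by linarith) (by linarith) h
    (fun T S hTS => Lg_mono _ _ fun ω ω' h => by
      simp only [Prod.mk.injEq, mask_eq_iff] at h ⊢
      exact ⟨h.1, fun t ht => h.2 t (hTS ht)⟩) univ
  have c1 : (k1 * k2 : ℝ) * Real.log k2 ≤
      Ex (1 - e2) univ h + n * (1 - e2) * (k1 * k2 * Real.log 2) := by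
    have := Ex_mono (p := 1 - e2) (by linarith) (by linarith) univ
      (h := fun _ => (k1 * k2 : ℝ) * Real.log k2)
      (h' := fun S => h S + (k1 * k2 * Real.log 2) * #S) (fun S _ => by
        have := mask_card f (fun m : Fin k1 × Fin k2 => m.1) S
        rw [hN, Lg_fst] at this
        simp only [hh]; linarith)
    rw [Ex_const, Ex_add, Ex_mul, Ex_card, Finset.card_univ, Fintype.card_fin] at this
    linarith
  refine ⟨?_, ?_⟩ <;> refine le_of_mul_le_mul_left ?_ hk
  · linarith
  · linarith

end Converse

section Outer

lemma lim_lemma {T c C : ℝ} (h : ∀ ε : ℝ, 0 < ε → ε < 1 → ∀ a : ℝ, 1 ≤ a →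
    (1 - ε) * T ≤ c + C * (ε * Real.log a + 1 / a)) : T ≤ c := by
  have h1 : ∀ a : ℝ, 1 ≤ a → T ≤ c + C * (1 / a) := by
    intro a ha
    have l1 : Filter.Tendsto (fun ε : ℝ => (1 - ε) * T) (nhdsWithin 0 (Set.Ioi 0)) (nhds T) := by
      have : Continuous (fun ε : ℝ => (1 - ε) * T) := by fun_prop
      have h := (this.tendsto 0).mono_left (nhdsWithin_le_nhds (s := Set.Ioi (0:ℝ)))
      simpa using h
    have l2 : Filter.Tendsto (fun ε : ℝ => c + C * (ε * Real.log a + 1 / a))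
        (nhdsWithin 0 (Set.Ioi 0)) (nhds (c + C * (1 / a))) := by
      have : Continuous (fun ε : ℝ => c + C * (ε * Real.log a + 1 / a)) := by fun_prop
      have h := (this.tendsto 0).mono_left (nhdsWithin_le_nhds (s := Set.Ioi (0:ℝ)))
      simpa using h
    refine le_of_tendsto_of_tendsto l1 l2 ?_
    filter_upwards [Ioo_mem_nhdsGT (show (0:ℝ) < 1 by norm_num)] with ε hε
    exact h ε hε.1 hε.2 a ha
  have l2 : Filter.Tendsto (fun a : ℝ => c + C * (1 / a)) Filter.atTop (nhds (c + C * 0)) := by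
    have l0 : Filter.Tendsto (fun a : ℝ => 1 / a) Filter.atTop (nhds 0) := by
      simp only [one_div]
      exact tendsto_inv_atTop_zero
    exact tendsto_const_nhds.add (tendsto_const_nhds.mul l0)
  simp only [mul_zero, add_zero] at l2
  refine ge_of_tendsto l2 ?_
  filter_upwards [Filter.eventually_ge_atTop 1] with a ha using h1 a ha

lemma div_lemma {n T X c D ε : ℝ} (hn : 1 ≤ n) (hD : 0 ≤ D) (hε : ε < 1) (hX : n * T ≤ X)
    (h : (1 - ε) * X ≤ n * c + D) : (1 - ε) * T ≤ c + D := by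
  have h1 : (1 - ε) * (n * T) ≤ (1 - ε) * X := mul_le_mul_of_nonneg_left hX (by linarith)
  have h2 : n * ((1 - ε) * T) ≤ n * (c + D) := by nlinarith
  exact le_of_mul_le_mul_left h2 (by linarith)

lemma rate_log {n k : ℕ} (hn : 0 < n) {R : ℝ} (h : R ≤ Real.logb 2 (k:ℝ) / (n:ℝ)) :
    (n:ℝ) * (R * Real.log 2) ≤ Real.log k := by
  have hn' : (0:ℝ) < n := by exact_mod_cast hn
  have hl : 0 < Real.log 2 := Real.log_pos (by norm_num)
  rw [le_div_iff₀ hn', Real.logb, le_div_iff₀ hl] at h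
  linarith

variable {e1 e2 : ℝ} {W : Bool → Option Bool × Option Bool → ℝ}

lemma outer1 (he1 : 0 ≤ e1) (he12 : e1 ≤ e2) (he2 : e2 ≤ 1)
    (hW : IsChannel W) (hm1 : ∀ x y, margW1 W x y = BECk e1 x y)
    (hm2 : ∀ x y, margW2 W x y = BECk e2 x y) {R : ℝ × ℝ} (hR : Ach1 W R) :
    0 ≤ R.1 ∧ 0 ≤ R.2 ∧ R.1 ≤ 1 - e1 ∧ R.2 ≤ 1 - e2 ∧
      (1 - e2) * R.1 + (1 - e1) * R.2 ≤ (1 - e1) * (1 - e2) := by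
  obtain ⟨hR1, hR2, hR⟩ := hR
  have hl : 0 < Real.log 2 := Real.log_pos (by norm_num)
  refine ⟨hR1, hR2, ?_, ?_, ?_⟩ <;> refine le_of_mul_le_mul_right ?_ hl
  · refine lim_lemma (C := 1) fun ε h0 h1 a ha => ?_
    obtain ⟨n, k1, k2, hn, hk1, hk2, f, g1, g2, r1, r2, he⟩ := hR ε h0
    have hc := converse1 he1 he12 he2 hW hm1 hm2 hk1 hk2 f g1 g2 ha he
    have hD : 0 ≤ ε * Real.log a + 1 / a := by have := Real.log_nonneg ha; positivity
    exact div_lemma (n := n) (by exact_mod_cast hn) (by linarith) h1 (rate_log hn r1)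
      (by linarith [hc.1])
  · refine lim_lemma (C := 1) fun ε h0 h1 a ha => ?_
    obtain ⟨n, k1, k2, hn, hk1, hk2, f, g1, g2, r1, r2, he⟩ := hR ε h0
    have hc := converse1 he1 he12 he2 hW hm1 hm2 hk1 hk2 f g1 g2 ha he
    have hD : 0 ≤ ε * Real.log a + 1 / a := by have := Real.log_nonneg ha; positivity
    exact div_lemma (n := n) (by exact_mod_cast hn) (by linarith) h1 (rate_log hn r2)
      (by linarith [hc.2.1])
  · refine lim_lemma (C := (1 - e2) + (1 - e1)) fun ε h0 h1 a ha => ?_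
    obtain ⟨n, k1, k2, hn, hk1, hk2, f, g1, g2, r1, r2, he⟩ := hR ε h0
    have hc := converse1 he1 he12 he2 hW hm1 hm2 hk1 hk2 f g1 g2 ha he
    have hD : 0 ≤ ε * Real.log a + 1 / a := by have := Real.log_nonneg ha; positivity
    have q1 : 0 ≤ 1 - e1 := by linarith
    have q2 : 0 ≤ 1 - e2 := by linarith
    have w1 := mul_le_mul_of_nonneg_left (rate_log hn r1) q2
    have w2 := mul_le_mul_of_nonneg_left (rate_log hn r2) q1
    exact div_lemma (n := n) (X := (1 - e2) * Real.log k1 + (1 - e1) * Real.log k2)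
      (by exact_mod_cast hn) (by positivity) h1 (by linarith)
      (by linarith [hc.2.2])

lemma outer2 (he1 : 0 ≤ e1) (he12 : e1 ≤ e2) (he2 : e2 ≤ 1)
    (hW : IsChannel W) (hm1 : ∀ x y, margW1 W x y = BECk e1 x y)
    (hm2 : ∀ x y, margW2 W x y = BECk e2 x y) {R : ℝ × ℝ} (hR : Ach2 W R) :
    0 ≤ R.1 ∧ 0 ≤ R.2 ∧ R.2 ≤ 1 - e2 ∧ R.1 + R.2 ≤ 1 - e1 := by
  obtain ⟨hR1, hR2, hR⟩ := hR
  have hl : 0 < Real.log 2 := Real.log_pos (by norm_num)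
  refine ⟨hR1, hR2, ?_, ?_⟩ <;> refine le_of_mul_le_mul_right ?_ hl
  · refine lim_lemma (C := 1) fun ε h0 h1 a ha => ?_
    obtain ⟨n, k1, k2, hn, hk1, hk2, f, g1, g2, r1, r2, he⟩ := hR ε h0
    have hc := converse2 he1 he12 he2 hW hm1 hm2 hk1 hk2 f g1 g2 ha he
    have hD : 0 ≤ ε * Real.log a + 1 / a := by have := Real.log_nonneg ha; positivity
    exact div_lemma (n := n) (by exact_mod_cast hn) (by linarith) h1 (rate_log hn r2)
      (by linarith [hc.1])
  · refine lim_lemma (C := 2) fun ε h0 h1 a ha => ?_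
    obtain ⟨n, k1, k2, hn, hk1, hk2, f, g1, g2, r1, r2, he⟩ := hR ε h0
    have hc := converse2 he1 he12 he2 hW hm1 hm2 hk1 hk2 f g1 g2 ha he
    have hD : 0 ≤ ε * Real.log a + 1 / a := by have := Real.log_nonneg ha; positivity
    have w1 := rate_log hn r1
    have w2 := rate_log hn r2
    exact div_lemma (n := n) (X := Real.log k1 + Real.log k2)
      (by exact_mod_cast hn) (by positivity) h1 (by linarith)
      (by linarith [hc.2])

lemma CBEBC_eq (he12 : e1 ≤ e2) (he2 : e2 ≤ 1) :
    CBEBC e1 e2 = {R : ℝ × ℝ | 0 ≤ R.1 ∧ 0 ≤ R.2 ∧ R.1 ≤ 1 - e1 ∧ R.2 ≤ 1 - e2 ∧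
      (1 - e2) * R.1 + (1 - e1) * R.2 ≤ (1 - e1) * (1 - e2)} := by
  have q1 : 0 ≤ 1 - e1 := by linarith
  have q2 : 0 ≤ 1 - e2 := by linarith
  ext R
  simp only [CBEBC, Set.mem_ofPred_eq, Set.mem_Icc]
  constructor
  · rintro ⟨h1, h2, β, ⟨hb0, hb1⟩, r1, r2⟩
    refine ⟨h1, h2, by nlinarith, by nlinarith, ?_⟩
    have w1 := mul_le_mul_of_nonneg_left r1 q2
    have w2 := mul_le_mul_of_nonneg_left r2 q1
    nlinarith
  · rintro ⟨h1, h2, r1, r2, r3⟩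
    refine ⟨h1, h2, ?_⟩
    rcases eq_or_lt_of_le q1 with hq | hq
    · exact ⟨0, ⟨le_rfl, zero_le_one⟩, by linarith, by linarith⟩
    · refine ⟨R.1 / (1 - e1), ⟨by positivity, by rw [div_le_one hq]; exact r1⟩, ?_, ?_⟩
      · rw [div_mul_cancel₀ _ hq.ne']
      · refine le_of_mul_le_mul_left ?_ hq
        have : (1 - e1) * ((1 - R.1 / (1 - e1)) * (1 - e2)) = (1 - e1) * (1 - e2) - R.1 * (1 - e2) := by
          field_simp
        rw [this]; linarith

lemma closed1 : IsClosed {R : ℝ × ℝ | 0 ≤ R.1 ∧ 0 ≤ R.2 ∧ R.1 ≤ 1 - e1 ∧ R.2 ≤ 1 - e2 ∧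
      (1 - e2) * R.1 + (1 - e1) * R.2 ≤ (1 - e1) * (1 - e2)} := by
  simp only [Set.ofPred_and]
  refine IsClosed.inter ?_ (IsClosed.inter ?_ (IsClosed.inter ?_ (IsClosed.inter ?_ ?_))) <;>
    exact isClosed_le (by fun_prop) (by fun_prop)

lemma closed2 : IsClosed {R : ℝ × ℝ | 0 ≤ R.1 ∧ 0 ≤ R.2 ∧ R.2 ≤ 1 - e2 ∧ R.1 + R.2 ≤ 1 - e1} := by
  simp only [Set.ofPred_and]
  refine IsClosed.inter ?_ (IsClosed.inter ?_ (IsClosed.inter ?_ ?_)) <;>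
    exact isClosed_le (by fun_prop) (by fun_prop)

lemma Ach0_Ach1 {R : ℝ × ℝ} (h : Ach0 W R) : Ach1 W R := by
  obtain ⟨h1, h2, h⟩ := h
  refine ⟨h1, h2, fun ε hε => ?_⟩
  obtain ⟨n, k1, k2, hn, hk1, hk2, f, g1, g2, r1, r2, he⟩ := h ε hε
  refine ⟨n, k1, k2, hn, hk1, hk2, f, fun y => g1 y.1, g2, r1, r2, ?_⟩
  rw [errP0_eq] at he
  rw [errP1_eq]
  exact he

end Outer

section Achievability

lemma count_code {M : Type} [Fintype M] [DecidableEq M] {n : ℕ} {m m' : M} (hm : m' ≠ m)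
    (D : Finset (Fin n)) :
    (∑ f : M → Fin n → Bool, if ∀ t ∈ D, f m' t = f m t then (1:ℝ) else 0) ≤
      Fintype.card (M → Fin n → Bool) * (1 / 2) ^ #D := by
  have hcard : Fintype.card ({f : M → Fin n → Bool // ∀ t ∈ D, f m' t = f m t} × (D → Bool)) ≤
      Fintype.card (M → Fin n → Bool) := by
    refine Fintype.card_le_of_injective
      (fun q => Function.update q.1.1 m' (fun t => if h : t ∈ D then q.2 ⟨t, h⟩ else q.1.1 m' t)) ?_
    rintro ⟨⟨f, hf⟩, v⟩ ⟨⟨f', hf'⟩, v'⟩ h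
    simp only at h
    have hne : ∀ x, x ≠ m' → f x = f' x := fun x hx => by
      have := congrFun h x
      simpa [Function.update_of_ne hx] using this
    have hm' := congrFun h m'
    simp only [Function.update_self] at hm'
    have hff : f = f' := by
      funext x
      by_cases hx : x = m'
      · subst hx
        funext t
        by_cases ht : t ∈ D
        · rw [hf t ht, hf' t ht, hne m hm.symm]
        · have := congrFun hm' t
          simpa [ht] using this
      · exact hne x hx
    have hvv : v = v' := by
      funext ⟨t, ht⟩
      have := congrFun hm' t
      simpa [ht] using this
    subst hff; subst hvv; rfl
  rw [Fintype.card_prod, Fintype.card_fun (α := D), Fintype.card_bool, Fintype.card_coe,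
    Fintype.card_subtype] at hcard
  rw [Finset.sum_boole]
  have h2 : ((#{f : M → Fin n → Bool | ∀ t ∈ D, f m' t = f m t} : ℕ) : ℝ) * 2 ^ #D ≤
      (Fintype.card (M → Fin n → Bool) : ℝ) := by exact_mod_cast hcard
  rw [one_div, inv_pow, ← div_eq_mul_inv, le_div_iff₀ (by positivity)]
  exact h2

lemma le_rpow_aux {x y s : ℝ} (hs0 : 0 < s) (hs1 : s ≤ 1) (hy1 : y ≤ 1) (hx : 0 ≤ x)
    (hyx : y ≤ x) : y ≤ x ^ s := by
  rcases le_total 1 x with h | h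
  · exact hy1.trans (Real.one_le_rpow h hs0.le)
  · rcases eq_or_lt_of_le hx with h0 | h0
    · rw [← h0, Real.zero_rpow hs0.ne']; linarith
    · calc y ≤ x := hyx
        _ = x ^ (1:ℝ) := (Real.rpow_one x).symm
        _ ≤ x ^ s := Real.rpow_le_rpow_of_exponent_ge h0 h hs1

/-- The message `m` is confusable with a message of `C m`, seen through `D`. -/
def Bad {M : Type} {n : ℕ} (f : M → Fin n → Bool) (C : M → Finset M) (m : M)
    (D : Finset (Fin n)) : Prop := ∃ m' ∈ C m, ∀ t ∈ D, f m' t = f m t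

lemma bad_count {M : Type} [Fintype M] [DecidableEq M] {n : ℕ} (C : M → Finset M) (m : M)
    (hC : m ∉ C m) {K s : ℝ} (hK : (#(C m) : ℝ) ≤ K) (hs0 : 0 < s) (hs1 : s ≤ 1)
    (D : Finset (Fin n)) :
    (∑ f : M → Fin n → Bool, if Bad f C m D then (1:ℝ) else 0) ≤
      Fintype.card (M → Fin n → Bool) * (K ^ s * ((1 / 2 : ℝ) ^ s) ^ #D) := by
  have hK0 : 0 ≤ K := le_trans (by positivity) hK
  set F : ℝ := ((Fintype.card (M → Fin n → Bool) : ℕ) : ℝ) with hF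
  have hFpos : 0 < F := by
    have : 0 < Fintype.card (M → Fin n → Bool) := Fintype.card_pos
    simp only [hF]; exact_mod_cast this
  set Q := ∑ f : M → Fin n → Bool, if Bad f C m D then (1:ℝ) else 0 with hQ
  have h1 : Q ≤ F := by
    calc Q ≤ ∑ _f : M → Fin n → Bool, (1:ℝ) :=
          Finset.sum_le_sum fun f _ => by split_ifs <;> norm_num
      _ = F := by simp [hF]
  have h2 : Q ≤ F * (K * (1 / 2) ^ #D) := by
    calc Q ≤ ∑ f : M → Fin n → Bool, ∑ m' ∈ C m,
            (if ∀ t ∈ D, f m' t = f m t then (1:ℝ) else 0) := by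
          refine Finset.sum_le_sum fun f _ => ?_
          by_cases hb : Bad f C m D
          · obtain ⟨m', hm', h⟩ := hb
            have hb : Bad f C m D := ⟨m', hm', h⟩
            rw [if_pos hb]
            calc (1:ℝ) = (if ∀ t ∈ D, f m' t = f m t then (1:ℝ) else 0) := (if_pos h).symm
              _ ≤ _ := Finset.single_le_sum
                  (f := fun m' => if ∀ t ∈ D, f m' t = f m t then (1:ℝ) else 0)
                  (fun i _ => by positivity) hm'
          · rw [if_neg hb]
            exact Finset.sum_nonneg fun i _ => by positivity
      _ = ∑ m' ∈ C m, ∑ f : M → Fin n → Bool,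
            (if ∀ t ∈ D, f m' t = f m t then (1:ℝ) else 0) := Finset.sum_comm
      _ ≤ ∑ m' ∈ C m, F * (1 / 2) ^ #D := Finset.sum_le_sum fun m' hm' =>
          count_code (m := m) (m' := m') (fun h => hC (by rw [h] at hm'; exact hm')) D
      _ = #(C m) * (F * (1 / 2) ^ #D) := by simp
      _ ≤ K * (F * (1 / 2) ^ #D) := mul_le_mul_of_nonneg_right hK (by positivity)
      _ = _ := by ring
  have h3 : Q / F ≤ (K * (1 / 2) ^ #D) ^ s :=
    le_rpow_aux hs0 hs1 (by rw [div_le_one hFpos]; exact h1) (by positivity)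
      (by rw [div_le_iff₀ hFpos]; linarith)
  rw [Real.mul_rpow hK0 (by positivity), ← Real.rpow_natCast, ← Real.rpow_mul (by norm_num),
    mul_comm ((#D : ℕ) : ℝ) s, Real.rpow_mul (by norm_num), Real.rpow_natCast,
    div_le_iff₀ hFpos] at h3
  linarith

/-- Average probability of a bad event for code `f`. -/
def avgBad {M : Type} [Fintype M] {n : ℕ} (p : ℝ) (A : Finset (Fin n)) (C : M → Finset M)
    (f : M → Fin n → Bool) : ℝ :=
  1 / (Fintype.card M : ℝ) * ∑ m, Ex p univ (fun S => if Bad f C m (S ∩ A) then (1:ℝ) else 0)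

lemma avg_code {M : Type} [Fintype M] [DecidableEq M] [Nonempty M] {n : ℕ} {p : ℝ} (hp0 : 0 ≤ p)
    (hp1 : p ≤ 1) (A : Finset (Fin n)) (C : M → Finset M) (hC : ∀ m, m ∉ C m) {K s : ℝ}
    (hK : ∀ m, (#(C m) : ℝ) ≤ K) (hs0 : 0 < s) (hs1 : s ≤ 1) :
    ∑ f : M → Fin n → Bool, avgBad p A C f ≤
      Fintype.card (M → Fin n → Bool) * (K ^ s * (p * (1 / 2 : ℝ) ^ s + (1 - p)) ^ #A) := by
  have hM : (0:ℝ) < Fintype.card M := by exact_mod_cast Fintype.card_pos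
  unfold avgBad
  rw [← Finset.mul_sum, Finset.sum_comm, one_div, inv_mul_le_iff₀ hM]
  calc _ ≤ ∑ _m : M, Fintype.card (M → Fin n → Bool) *
        (K ^ s * (p * (1 / 2 : ℝ) ^ s + (1 - p)) ^ #A) := by
        refine Finset.sum_le_sum fun m _ => ?_
        rw [← Ex_sum]
        calc _ ≤ Ex p univ (fun S => (Fintype.card (M → Fin n → Bool) * K ^ s)
                * ((1 / 2 : ℝ) ^ s) ^ #(S ∩ A)) :=
              Ex_mono hp0 hp1 _ fun S _ => by
                have := bad_count C m (hC m) (hK m) hs0 hs1 (S ∩ A)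
                rw [← mul_assoc] at this
                exact this
          _ = _ := by rw [Ex_mul, Ex_pow, Finset.univ_inter, mul_assoc]
    _ = _ := by simp

lemma exists_le_avg {F : Type} [Fintype F] [Nonempty F] (G : F → ℝ) (c : ℝ)
    (h : ∑ f, G f ≤ Fintype.card F * c) : ∃ f, G f ≤ c := by
  by_contra hc
  push Not at hc
  have : ∑ _f : F, c < ∑ f, G f :=
    Finset.sum_lt_sum_of_nonempty Finset.univ_nonempty fun f _ => hc f
  simp at this
  linarith

lemma dec_exists {M : Type} [Nonempty M] {n : ℕ} (F : M → Fin n → Bool) (A : Finset (Fin n)) :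
    ∃ g : (Fin n → Option Bool) → M, ∀ (S : Finset (Fin n)) (x : Fin n → Bool) (m : M),
      (∀ t ∈ A, x t = F m t) →
      (∀ m', m' ≠ m → ¬ ∀ t ∈ S ∩ A, F m' t = F m t) → g (mask S x) = m := by
  refine ⟨fun y => if h : ∃ m, ∀ t ∈ A, y t = none ∨ y t = some (F m t) then h.choose
    else Classical.arbitrary M, fun S x m hx hm => ?_⟩
  have hex : ∃ m, ∀ t ∈ A, mask S x t = none ∨ mask S x t = some (F m t) := by
    refine ⟨m, fun t ht => ?_⟩
    by_cases hS : t ∈ S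
    · right; simp [mask, hS, hx t ht]
    · left; simp [mask, hS]
  simp only [dif_pos hex]
  by_contra hne
  refine hm _ hne fun t ht => ?_
  have hS := (Finset.mem_inter.1 ht).1
  have hA := (Finset.mem_inter.1 ht).2
  have := hex.choose_spec t hA
  simp only [mask, hS, if_true, reduceCtorEq, false_or, Option.some.injEq] at this
  exact this.symm.trans (hx t hA)

lemma decay {R p β : ℝ} (hR : 0 ≤ R) (hp0 : 0 ≤ p) (hp1 : p ≤ 1) (hb0 : 0 ≤ β) (hb1 : β ≤ 1)
    (h : R = 0 ∨ R < β * p) {δ : ℝ} (hδ : 0 < δ) :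
    ∃ s : ℝ, 0 < s ∧ s ≤ 1 ∧ ∃ n0 : ℕ, ∀ n : ℕ, n0 ≤ n → ∀ (K : ℝ) (A : ℕ), 0 ≤ K →
      K ≤ 4 * (2:ℝ) ^ ((n:ℝ) * R) → (R = 0 → K = 0) → β * n ≤ A + 1 →
      K ^ s * (p * (1 / 2 : ℝ) ^ s + (1 - p)) ^ A ≤ δ := by
  by_cases hR0 : R = 0
  · refine ⟨1, one_pos, le_rfl, 0, fun n _ K A _ _ hK _ => ?_⟩
    rw [hK hR0]; simp [hδ.le]
  have h : R < β * p := h.resolve_left hR0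
  have hl0 : 0 < Real.log 2 := Real.log_pos (by norm_num)
  have hl1 : Real.log 2 < 1 := by linarith [Real.log_two_lt_d9]
  have hbp : β * p ≤ 1 := by nlinarith
  set s := (β * p - R) / 2 with hs
  have hs0 : 0 < s := by simp only [hs]; linarith
  have hs1 : s ≤ 1 := by simp only [hs]; linarith
  set u := s * Real.log 2 with hu
  have hu0 : 0 < u := by positivity
  have hus : u ≤ s := by nlinarith
  set v := p * (u / (1 + u)) with hv
  have hv0 : 0 ≤ v := by positivity
  set θ := v * β - R * u with hθ
  have hθ0 : 0 < θ := by
    have : θ = u * (β * p / (1 + u) - R) := by simp only [hθ, hv]; field_simp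
    rw [this]
    refine mul_pos hu0 ?_
    rw [sub_pos, lt_div_iff₀ (by positivity)]
    have : R * u ≤ s := by nlinarith
    nlinarith
  have hhalf : (1 / 2 : ℝ) ^ s = Real.exp (-u) := by
    rw [Real.rpow_def_of_pos (by norm_num), one_div, Real.log_inv]
    congr 1; simp only [hu]; ring
  have hexp : Real.exp (-u) ≤ 1 / (1 + u) := by
    rw [Real.exp_neg, ← one_div]
    exact one_div_le_one_div_of_le (by positivity) (by linarith [Real.add_one_le_exp u])
  have hb : p * (1 / 2 : ℝ) ^ s + (1 - p) ≤ Real.exp (-v) := by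
    rw [hhalf]
    have e1 : p * Real.exp (-u) ≤ p * (1 / (1 + u)) := mul_le_mul_of_nonneg_left hexp hp0
    have e2 : p * (1 / (1 + u)) = p - v := by simp only [hv]; field_simp; ring
    linarith [Real.add_one_le_exp (-v)]
  have hbnn : 0 ≤ p * (1 / 2 : ℝ) ^ s + (1 - p) := by
    have : 0 ≤ 1 - p := by linarith
    positivity
  set c := (4:ℝ) ^ s * Real.exp v with hc
  have lim : Filter.Tendsto (fun n : ℕ => c * Real.exp (-(θ * n))) Filter.atTop (nhds (c * 0)) := by
    refine tendsto_const_nhds.mul ?_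
    refine Real.tendsto_exp_neg_atTop_nhds_zero.comp ?_
    exact tendsto_natCast_atTop_atTop.const_mul_atTop hθ0
  rw [mul_zero] at lim
  obtain ⟨n0, hn0⟩ := Filter.eventually_atTop.1 (lim.eventually_le_const hδ)
  refine ⟨s, hs0, hs1, n0, fun n hn K A hK0 hK _ hA => le_trans ?_ (hn0 n hn)⟩
  have k1 : K ^ s ≤ (4:ℝ) ^ s * Real.exp (R * u * n) := by
    calc K ^ s ≤ (4 * (2:ℝ) ^ ((n:ℝ) * R)) ^ s := Real.rpow_le_rpow hK0 hK hs0.le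
      _ = (4:ℝ) ^ s * Real.exp (R * u * n) := by
        rw [Real.mul_rpow (by norm_num) (by positivity), ← Real.rpow_mul (by norm_num),
          Real.rpow_def_of_pos (show (0:ℝ) < 2 by norm_num)]
        congr 2; simp only [hu]; ring
  have k2 : (p * (1 / 2 : ℝ) ^ s + (1 - p)) ^ A ≤ Real.exp (v - v * β * n) := by
    calc _ ≤ (Real.exp (-v)) ^ A := pow_le_pow_left₀ hbnn hb A
      _ = Real.exp (A * (-v)) := (Real.exp_nat_mul _ _).symm
      _ ≤ _ := Real.exp_le_exp.2 (by nlinarith)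
  calc _ ≤ ((4:ℝ) ^ s * Real.exp (R * u * n)) * Real.exp (v - v * β * n) :=
        mul_le_mul k1 k2 (by positivity) (by positivity)
    _ = c * Real.exp (-(θ * n)) := by
        have h5 : Real.exp (R * u * n) * Real.exp (v - v * β * n) =
            Real.exp v * Real.exp (-(θ * n)) := by
          rw [← Real.exp_add, ← Real.exp_add]
          congr 1; simp only [hθ]; ring
        rw [hc, mul_assoc, h5]; ring

/-- Number of messages at rate `R`. -/
def kR (R : ℝ) (n : ℕ) : ℕ := ⌈(2:ℝ) ^ ((n:ℝ) * R)⌉₊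

lemma kR_pos (R : ℝ) (n : ℕ) : 0 < kR R n := Nat.ceil_pos.2 (by positivity)

lemma kR_zero (n : ℕ) : kR 0 n = 1 := by simp [kR]

lemma kR_lt (R : ℝ) (n : ℕ) : (kR R n : ℝ) < (2:ℝ) ^ ((n:ℝ) * R) + 1 :=
  Nat.ceil_lt_add_one (by positivity)

lemma kR_rate (R : ℝ) {n : ℕ} (hn : 0 < n) : R ≤ Real.logb 2 (kR R n : ℝ) / (n:ℝ) := by
  have hn' : (0:ℝ) < n := by exact_mod_cast hn
  rw [le_div_iff₀ hn', Real.le_logb_iff_rpow_le (by norm_num) (by exact_mod_cast kR_pos R n),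
    mul_comm]
  exact Nat.le_ceil _

variable {e1 e2 : ℝ} {W : Bool → Option Bool × Option Bool → ℝ}

lemma sum_fst_aux {k1 k2 : ℕ} (G : Fin k1 → ℝ) :
    ∑ m : Fin k1 × Fin k2, G m.1 = k2 * ∑ a, G a := by
  rw [Fintype.sum_prod_type]; simp [Finset.mul_sum]

lemma sum_snd_aux {k1 k2 : ℕ} (G : Fin k2 → ℝ) :
    ∑ m : Fin k1 × Fin k2, G m.2 = k1 * ∑ a, G a := by
  rw [Fintype.sum_prod_type]; simp

lemma ach0 (he1 : 0 ≤ e1) (he12 : e1 ≤ e2) (he2 : e2 ≤ 1)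
    (hW : IsChannel W) (hm1 : ∀ x y, margW1 W x y = BECk e1 x y)
    (hm2 : ∀ x y, margW2 W x y = BECk e2 x y) {R1 R2 β : ℝ} (hR1 : 0 ≤ R1) (hR2 : 0 ≤ R2)
    (hb0 : 0 ≤ β) (hb1 : β ≤ 1)
    (h1 : R1 = 0 ∨ R1 < β * (1 - e1)) (h2 : R2 = 0 ∨ R2 < (1 - β) * (1 - e2)) :
    Ach0 W (R1, R2) := by
  refine ⟨hR1, hR2, fun ε hε => ?_⟩
  obtain ⟨s, hs0, hs1, n1, hn1⟩ := decay hR1 (by linarith : 0 ≤ 1 - e1) (by linarith) hb0 hb1 h1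
    (half_pos hε)
  obtain ⟨s', hs0', hs1', n2, hn2⟩ := decay hR2 (by linarith : 0 ≤ 1 - e2) (by linarith)
    (by linarith : 0 ≤ 1 - β) (by linarith) h2 (half_pos hε)
  obtain ⟨n, hn, hnn1, hnn2⟩ : ∃ n : ℕ, 0 < n ∧ n1 ≤ n ∧ n2 ≤ n :=
    ⟨n1 + n2 + 1, by omega, by omega, by omega⟩
  have hfl : ⌊β * n⌋₊ ≤ #(univ : Finset (Fin n)) := by
    rw [Finset.card_univ, Fintype.card_fin]
    refine Nat.floor_le_of_le ?_
    have : (0:ℝ) ≤ n := by positivity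
    nlinarith
  obtain ⟨A, -, hA⟩ := Finset.exists_subset_card_eq hfl
  have hA1 : β * n ≤ (#A : ℝ) + 1 := by rw [hA]; exact (Nat.lt_floor_add_one _).le
  have hA2 : (1 - β) * n ≤ (#Aᶜ : ℝ) + 1 := by
    have hle : (#A : ℝ) ≤ β * n := by rw [hA]; exact Nat.floor_le (by positivity)
    have : (#A : ℝ) + #Aᶜ = n := by
      have := Finset.card_add_card_compl A
      rw [Fintype.card_fin] at this
      exact_mod_cast this
    linarith
  have hk1 := kR_pos R1 n
  have hk2 := kR_pos R2 n
  have l1 := kR_lt R1 n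
  have l2 := kR_lt R2 n
  have z1 : R1 = 0 → kR R1 n = 1 := fun h => by rw [h, kR_zero]
  have z2 : R2 = 0 → kR R2 n = 1 := fun h => by rw [h, kR_zero]
  have rr1 := kR_rate R1 hn
  have rr2 := kR_rate R2 hn
  generalize kR R1 n = k1 at *
  generalize kR R2 n = k2 at *
  have i1 : Nonempty (Fin k1) := ⟨⟨0, hk1⟩⟩
  have i2 : Nonempty (Fin k2) := ⟨⟨0, hk2⟩⟩
  have hk1' : (1:ℝ) ≤ k1 := by exact_mod_cast hk1
  have hk2' : (1:ℝ) ≤ k2 := by exact_mod_cast hk2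
  have pw1 : (0:ℝ) < (2:ℝ) ^ ((n:ℝ) * R1) := by positivity
  have pw2 : (0:ℝ) < (2:ℝ) ^ ((n:ℝ) * R2) := by positivity
  obtain ⟨F1, hF1⟩ := exists_le_avg (F := Fin k1 → Fin n → Bool) _ _
    (avg_code (M := Fin k1) (n := n) (p := 1 - e1) (by linarith) (by linarith) A
      (fun m => univ.erase m) (by simp) (K := (k1:ℝ) - 1) (s := s)
      (fun m => by rw [Finset.card_erase_of_mem (Finset.mem_univ _), Finset.card_univ,
        Fintype.card_fin, Nat.cast_sub hk1]; simp) hs0 hs1)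
  obtain ⟨F2, hF2⟩ := exists_le_avg (F := Fin k2 → Fin n → Bool) _ _
    (avg_code (M := Fin k2) (n := n) (p := 1 - e2) (by linarith) (by linarith) Aᶜ
      (fun m => univ.erase m) (by simp) (K := (k2:ℝ) - 1) (s := s')
      (fun m => by rw [Finset.card_erase_of_mem (Finset.mem_univ _), Finset.card_univ,
        Fintype.card_fin, Nat.cast_sub hk2]; simp) hs0' hs1')
  have b1 := hF1.trans (hn1 n hnn1 ((k1:ℝ) - 1) #A (by linarith) (by linarith)
    (fun h => by rw [z1 h]; simp) hA1)
  have b2 := hF2.trans (hn2 n hnn2 ((k2:ℝ) - 1) #Aᶜ (by linarith) (by linarith)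
    (fun h => by rw [z2 h]; simp) hA2)
  obtain ⟨g1, hg1⟩ := dec_exists F1 A
  obtain ⟨g2, hg2⟩ := dec_exists F2 Aᶜ
  refine ⟨n, k1, k2, hn, hk1, hk2, fun m t => if t ∈ A then F1 m.1 t else F2 m.2 t, g1, g2,
    rr1, rr2, ?_⟩
  rw [errP0_eq]
  refine (errG_ub hW hm1 hm2 _ _ _).trans ?_
  have t1 : (∑ m : Fin k1 × Fin k2, Ex (1 - e1) univ (fun S =>
      if g1 (mask S (fun t => if t ∈ A then F1 m.1 t else F2 m.2 t)) = m.1 then (0:ℝ) else 1))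
      ≤ k1 * k2 * avgBad (1 - e1) A (fun m => univ.erase m) F1 := by
    calc _ ≤ ∑ m : Fin k1 × Fin k2, Ex (1 - e1) univ (fun S =>
          if Bad F1 (fun m => univ.erase m) m.1 (S ∩ A) then (1:ℝ) else 0) := by
          refine Finset.sum_le_sum fun m _ => Ex_mono (by linarith) (by linarith) _ fun S _ => ?_
          by_cases hb : Bad F1 (fun m => univ.erase m) m.1 (S ∩ A)
          · rw [if_pos hb]; split_ifs <;> norm_num
          · rw [if_neg hb, if_pos]
            refine hg1 S _ m.1 (fun t ht => by simp [ht]) fun m' hm' hall => hb ⟨m', ?_, hall⟩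
            simp [hm']
      _ = _ := by
          rw [sum_fst_aux (fun a => Ex (1 - e1) univ (fun S =>
            if Bad F1 (fun m => univ.erase m) a (S ∩ A) then (1:ℝ) else 0))]
          unfold avgBad
          rw [Fintype.card_fin]
          field_simp
  have t2 : (∑ m : Fin k1 × Fin k2, Ex (1 - e2) univ (fun S =>
      if g2 (mask S (fun t => if t ∈ A then F1 m.1 t else F2 m.2 t)) = m.2 then (0:ℝ) else 1))
      ≤ k1 * k2 * avgBad (1 - e2) Aᶜ (fun m => univ.erase m) F2 := by
    calc _ ≤ ∑ m : Fin k1 × Fin k2, Ex (1 - e2) univ (fun S =>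
          if Bad F2 (fun m => univ.erase m) m.2 (S ∩ Aᶜ) then (1:ℝ) else 0) := by
          refine Finset.sum_le_sum fun m _ => Ex_mono (by linarith) (by linarith) _ fun S _ => ?_
          by_cases hb : Bad F2 (fun m => univ.erase m) m.2 (S ∩ Aᶜ)
          · rw [if_pos hb]; split_ifs <;> norm_num
          · rw [if_neg hb, if_pos]
            refine hg2 S _ m.2 (fun t ht => by simp [Finset.mem_compl.1 ht])
              fun m' hm' hall => hb ⟨m', ?_, hall⟩
            simp [hm']
      _ = _ := by
          rw [sum_snd_aux (fun a => Ex (1 - e2) univ (fun S =>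
            if Bad F2 (fun m => univ.erase m) a (S ∩ Aᶜ) then (1:ℝ) else 0))]
          unfold avgBad
          rw [Fintype.card_fin]
          field_simp
  have hk : (0:ℝ) < (k1:ℝ) * k2 := by positivity
  rw [one_div, inv_mul_le_iff₀ hk]
  have w1 := mul_le_mul_of_nonneg_left b1 hk.le
  have w2 := mul_le_mul_of_nonneg_left b2 hk.le
  have t12 := (add_le_add t1 t2).trans (show _ ≤ (k1:ℝ) * k2 * ε by linarith)
  convert t12

lemma ach2 (he1 : 0 ≤ e1) (he12 : e1 ≤ e2) (he2 : e2 ≤ 1)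
    (hW : IsChannel W) (hm1 : ∀ x y, margW1 W x y = BECk e1 x y)
    (hm2 : ∀ x y, margW2 W x y = BECk e2 x y) {R1 R2 : ℝ} (hR1 : 0 ≤ R1) (hR2 : 0 ≤ R2)
    (h1 : R1 + R2 = 0 ∨ R1 + R2 < 1 * (1 - e1)) (h2 : R2 = 0 ∨ R2 < 1 * (1 - e2)) :
    Ach2 W (R1, R2) := by
  refine ⟨hR1, hR2, fun ε hε => ?_⟩
  obtain ⟨s, hs0, hs1, n1, hn1⟩ := decay (add_nonneg hR1 hR2) (by linarith : 0 ≤ 1 - e1)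
    (by linarith) zero_le_one le_rfl h1 (half_pos hε)
  obtain ⟨s', hs0', hs1', n2, hn2⟩ := decay hR2 (by linarith : 0 ≤ 1 - e2) (by linarith)
    zero_le_one le_rfl h2 (half_pos hε)
  obtain ⟨n, hn, hnn1, hnn2⟩ : ∃ n : ℕ, 0 < n ∧ n1 ≤ n ∧ n2 ≤ n :=
    ⟨n1 + n2 + 1, by omega, by omega, by omega⟩
  have hk1 := kR_pos R1 n
  have hk2 := kR_pos R2 n
  have l1 := kR_lt R1 n
  have l2 := kR_lt R2 n
  have z1 : R1 = 0 → kR R1 n = 1 := fun h => by rw [h, kR_zero]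
  have z2 : R2 = 0 → kR R2 n = 1 := fun h => by rw [h, kR_zero]
  have rr1 := kR_rate R1 hn
  have rr2 := kR_rate R2 hn
  generalize kR R1 n = k1 at *
  generalize kR R2 n = k2 at *
  have i1 : Nonempty (Fin k1) := ⟨⟨0, hk1⟩⟩
  have i2 : Nonempty (Fin k2) := ⟨⟨0, hk2⟩⟩
  have hk1' : (1:ℝ) ≤ k1 := by exact_mod_cast hk1
  have hk2' : (1:ℝ) ≤ k2 := by exact_mod_cast hk2
  have pw1 : (1:ℝ) ≤ (2:ℝ) ^ ((n:ℝ) * R1) := Real.one_le_rpow (by norm_num) (by positivity)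
  have pw2 : (1:ℝ) ≤ (2:ℝ) ^ ((n:ℝ) * R2) := Real.one_le_rpow (by norm_num) (by positivity)
  have hA1 : 1 * (n:ℝ) ≤ (#(univ : Finset (Fin n)) : ℝ) + 1 := by simp
  have hkk : (k1:ℝ) * k2 ≤ 4 * (2:ℝ) ^ ((n:ℝ) * (R1 + R2)) := by
    rw [mul_add, Real.rpow_add (by norm_num)]
    calc (k1:ℝ) * k2 ≤ (2 * (2:ℝ) ^ ((n:ℝ) * R1)) * (2 * (2:ℝ) ^ ((n:ℝ) * R2)) :=
          mul_le_mul (by linarith) (by linarith) (by linarith) (by linarith)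
      _ = _ := by ring
  have hkk1 : (1:ℝ) ≤ (k1:ℝ) * k2 := by nlinarith
  have v1 := avg_code (M := Fin k1 × Fin k2) (n := n) (p := 1 - e1) (by linarith) (by linarith) univ
      (fun m => univ.erase m) (by simp) (K := (k1:ℝ) * k2 - 1) (s := s)
      (fun m => by
        rw [Finset.card_erase_of_mem (Finset.mem_univ _), Finset.card_univ,
          Fintype.card_prod, Fintype.card_fin, Fintype.card_fin,
          Nat.cast_sub (Nat.mul_pos hk1 hk2)]
        simp) hs0 hs1
  have v2 := avg_code (M := Fin k1 × Fin k2) (n := n) (p := 1 - e2) (by linarith) (by linarith) univ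
      (fun m => (univ.erase m.2).image (fun x => (m.1, x))) (by
        intro m hm
        obtain ⟨x, hx, hxm⟩ := Finset.mem_image.1 hm
        rw [← hxm] at hx
        simp at hx) (K := (k2:ℝ) - 1) (s := s')
      (fun m => by
        have : #((univ.erase m.2).image (fun x => (m.1, x))) ≤ k2 - 1 :=
          Finset.card_image_le.trans (by
            rw [Finset.card_erase_of_mem (Finset.mem_univ _), Finset.card_univ, Fintype.card_fin])
        have h3 : ((k2 - 1 : ℕ) : ℝ) = (k2:ℝ) - 1 := by rw [Nat.cast_sub hk2]; simp
        rw [← h3]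
        exact_mod_cast this) hs0' hs1'
  obtain ⟨f, hf⟩ := exists_le_avg (F := Fin k1 × Fin k2 → Fin n → Bool) _ (_ + _)
    (by rw [mul_add, Finset.sum_add_distrib]; exact add_le_add v1 v2)
  have b1 := hn1 n hnn1 ((k1:ℝ) * k2 - 1) _ (by linarith) (by linarith)
    (fun h => by
      have hz1 : R1 = 0 := by linarith
      have hz2 : R2 = 0 := by linarith
      rw [z1 hz1, z2 hz2]; simp) hA1
  have b2 := hn2 n hnn2 ((k2:ℝ) - 1) _ (by linarith) (by linarith)
    (fun h => by rw [z2 h]; simp) hA1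
  obtain ⟨g1, hg1⟩ := dec_exists f univ
  choose g2 hg2 using fun m1 => dec_exists (fun m2 => f (m1, m2)) univ
  refine ⟨n, k1, k2, hn, hk1, hk2, f, fun y => (g1 y).1, fun y => g2 y.2 y.1, rr1, rr2, ?_⟩
  rw [errP2_eq]
  refine (errG_ub hW hm1 hm2 _ _ _).trans ?_
  refine le_trans ?_ (hf.trans (add_le_add b1 b2) |>.trans (by linarith))
  unfold avgBad
  rw [← mul_add, Fintype.card_prod, Fintype.card_fin, Fintype.card_fin, Nat.cast_mul]
  refine mul_le_mul_of_nonneg_left (add_le_add ?_ ?_) (by positivity)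
  · refine Finset.sum_le_sum fun m _ => Ex_mono (by linarith) (by linarith) _ fun S _ => ?_
    by_cases hb : Bad f (fun m => univ.erase m) m (S ∩ univ)
    · rw [if_pos hb]; split_ifs <;> norm_num
    · rw [if_neg hb, if_pos]
      rw [hg1 S _ m (fun t ht => rfl) fun m' hm' hall => hb ⟨m', by simp [hm'], hall⟩]
  · refine Finset.sum_le_sum fun m _ => Ex_mono (by linarith) (by linarith) _ fun S _ => ?_
    by_cases hb : Bad f (fun m => (univ.erase m.2).image (fun x => (m.1, x))) m (S ∩ univ)
    · rw [if_pos hb]; split_ifs <;> norm_num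
    · rw [if_neg hb, if_pos]
      exact hg2 m.1 S _ m.2 (fun t ht => rfl) fun m' hm' hall =>
        hb ⟨(m.1, m'), Finset.mem_image.2 ⟨m', by simp [hm'], rfl⟩, hall⟩

lemma mem_closure_scale {A : Set (ℝ × ℝ)} {R : ℝ × ℝ}
    (h : ∀ l : ℝ, 0 < l → l < 1 → (l * R.1, l * R.2) ∈ A) : R ∈ closure A := by
  have l1 : Filter.Tendsto (fun l : ℝ => (l * R.1, l * R.2)) (nhdsWithin 1 (Set.Iio 1))
      (nhds (1 * R.1, 1 * R.2)) := by
    have : Continuous (fun l : ℝ => (l * R.1, l * R.2)) := by fun_prop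
    exact (this.tendsto 1).mono_left nhdsWithin_le_nhds
  rw [one_mul, one_mul] at l1
  refine mem_closure_of_tendsto l1 ?_
  filter_upwards [Ioo_mem_nhdsLT (show (0:ℝ) < 1 by norm_num)] with l hl
  exact h l hl.1 hl.2

lemma scale_or {r c l : ℝ} (hr : 0 ≤ r) (h : r ≤ c) (hl1 : l < 1) :
    l * r = 0 ∨ l * r < c := by
  rcases eq_or_lt_of_le hr with h0 | h0
  · left; rw [← h0, mul_zero]
  · right; nlinarith

end Achievability

/-- **Proposition 5.** For `BE-BC(ε₁,ε₂)` with `0 ≤ ε₁ ≤ ε₂ ≤ 1`: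
`𝒞₁ = 𝒞 = 𝒞(BE-BC(ε₁,ε₂))` and
`𝒞₂ = {(R1,R2) ∈ ℝ²₊ : R2 ≤ 1 − ε₂, R1+R2 ≤ 1 − ε₁}`. -/
theorem bebc_capacity_regions
    (e1 e2 : ℝ) (he1 : 0 ≤ e1) (he12 : e1 ≤ e2) (he2 : e2 ≤ 1)
    (W : Bool → Option Bool × Option Bool → ℝ) (hW : IsChannel W)
    (hm1 : ∀ x y, margW1 W x y = BECk e1 x y)
    (hm2 : ∀ x y, margW2 W x y = BECk e2 x y) :
    Cap1 W = Cap W ∧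
    Cap W = CBEBC e1 e2 ∧
    Cap2 W = {R : ℝ × ℝ | 0 ≤ R.1 ∧ 0 ≤ R.2 ∧
      R.2 ≤ 1 - e2 ∧ R.1 + R.2 ≤ 1 - e1} := by
  have hcl1 : Cap1 W ⊆ CBEBC e1 e2 := by
    rw [CBEBC_eq he12 he2]
    exact closure_minimal (fun R hR => outer1 he1 he12 he2 hW hm1 hm2 hR) closed1
  have h01 : Cap W ⊆ Cap1 W := closure_mono fun R hR => Ach0_Ach1 hR
  have hin : CBEBC e1 e2 ⊆ Cap W := by
    rintro R ⟨hR1, hR2, β, ⟨hb0, hb1⟩, r1, r2⟩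
    refine mem_closure_scale fun l hl0 hl1 => ?_
    exact ach0 he1 he12 he2 hW hm1 hm2 (by positivity) (by positivity) hb0 hb1
      (scale_or hR1 r1 hl1) (scale_or hR2 r2 hl1)
  refine ⟨Set.Subset.antisymm (hcl1.trans hin) h01,
    Set.Subset.antisymm (h01.trans hcl1) hin, Set.Subset.antisymm ?_ ?_⟩
  · exact closure_minimal (fun R hR => outer2 he1 he12 he2 hW hm1 hm2 hR) closed2
  · rintro R ⟨hR1, hR2, r2, r12⟩
    refine mem_closure_scale fun l hl0 hl1 => ?_
    refine ach2 he1 he12 he2 hW hm1 hm2 (by positivity) (by positivity) ?_ ?_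
    · rw [← mul_add, one_mul]
      exact scale_or (add_nonneg hR1 hR2) r12 hl1
    · rw [one_mul]
      exact scale_or hR2 r2 hl1

end
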